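/- Let f : G → G be a graph map and let K be a connected closed subset of G with f(K) ∩ K ≠ ∅. Set X = O(K,f) and X_n = O_n(K,f), and suppose X − X_n ≠ ∅ for every n ≥ 1. Then the following eight conditions are equivalent: (1) K ∩ EP(f) = ∅; (2) X ∩ EP(f) = ∅; (3) X ∩ P(f) = ∅; (4) X ∩ R(f) = ∅; (5) X ∩ ω(f) = ∅; (6) X ∩ Ω(f) = ∅; (7) cl(X) − X ≠ ∅ and lim_{n→∞} d(fⁿ(x), cl(X) − X) = 0 for every x ∈ X; (8) there exists an open arc (u,v) ⊆ X − V(G) such that cl(X) − X = {v} ⊆ Fix(f), f(x) ∈ (x,v) for every x ∈ [u,v), and X ⊆ Ab((u,v), f). -/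

import Mathlib

open Set Function Filter Topology Metric

noncomputable section

/-- An open arc: a subspace homeomorphic to the open interval `(0,1)`. -/
def IsOpenArc {G : Type*} [TopologicalSpace G] (A : Set G) : Prop :=
  Nonempty (A ≃ₜ Set.Ioo (0 : ℝ) 1)

/-- A circle: a subspace homeomorphic to the unit circle. -/
def IsCircle {G : Type*} [TopologicalSpace G] (C : Set G) : Prop :=
  Nonempty (C ≃ₜ Metric.sphere (0 : ℂ) 1)

/-- A (topological) graph: a non-degenerate compact connected metric space with a finite
vertex set `V` such that every connected component of the complement of `V` is an open arc,
and every circle contains at least three vertices. -/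
structure IsTopGraph {G : Type*} [MetricSpace G] (V : Set G) : Prop where
  nontrivial : Nontrivial G
  compact : CompactSpace G
  connected : ConnectedSpace G
  finite_vertexSet : V.Finite
  component_openArc : ∀ x ∈ Vᶜ, IsOpenArc (connectedComponentIn Vᶜ x)
  circle_vertices : ∀ C : Set G, IsCircle C → 3 ≤ (C ∩ V).ncard

/-- The set of eventually periodic points: points with finite orbit. -/
def evPeriodicPts {G : Type*} (f : G → G) : Set G :=
  {x | (Set.range fun n : ℕ => f^[n] x).Finite}

/-- `EP_n(f)`: points whose orbit contains at most `n` points. -/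
def evPeriodicPtsLe {G : Type*} (f : G → G) (n : ℕ) : Set G :=
  {x | (Set.range fun i : ℕ => f^[i] x).encard ≤ n}

/-- The ω-limit set of a point `x` under `f`. -/
def omegaSet {G : Type*} [TopologicalSpace G] (f : G → G) (x : G) : Set G :=
  ⋂ i : ℕ, closure (Set.range fun n : ℕ => f^[n + i] x)

/-- The ω-limit set of `f`. -/
def omegaLimitSet {G : Type*} [TopologicalSpace G] (f : G → G) : Set G :=
  ⋃ x : G, omegaSet f x

/-- The set of recurrent points of `f`. -/
def recurrentPts {G : Type*} [TopologicalSpace G] (f : G → G) : Set G :=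
  {x | x ∈ omegaSet f x}

/-- The set of non-wandering points of `f`. -/
def nonwanderingPts {G : Type*} [TopologicalSpace G] (f : G → G) : Set G :=
  {x | ∀ U : Set G, IsOpen U → x ∈ U → ∃ n : ℕ, 0 < n ∧ (f^[n] '' U ∩ U).Nonempty}

/-- The set of almost periodic points of `f`. -/
def almostPeriodicPts {G : Type*} [TopologicalSpace G] (f : G → G) : Set G :=
  {x | ∀ U : Set G, IsOpen U → x ∈ U →
    ∃ m : ℕ, 0 < m ∧ ∀ n : ℕ, ∃ i : ℕ, 1 ≤ i ∧ i ≤ m ∧ f^[n + i] x ∈ U}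

/-- The ω-limit set of `x` under the restriction `f|K` (closures taken in the subspace `K`). -/
def omegaSetIn {G : Type*} [TopologicalSpace G] (f : G → G) (K : Set G) (x : G) : Set G :=
  ⋂ i : ℕ, (closure (Set.range fun n : ℕ => f^[n + i] x) ∩ K)

/-- The ω-limit set `ω(f|K)` of the restriction of `f` to `K`. -/
def omegaLimitSetIn {G : Type*} [TopologicalSpace G] (f : G → G) (K : Set G) : Set G :=
  ⋃ x ∈ K, omegaSetIn f K x

/-- The non-wandering set `Ω(f|K)` of the restriction of `f` to `K`. -/
def nonwanderingPtsIn {G : Type*} [TopologicalSpace G] (f : G → G) (K : Set G) : Set G :=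
  {x | x ∈ K ∧ ∀ U : Set G, IsOpen U → x ∈ U →
    ∃ n : ℕ, 0 < n ∧ (f^[n] '' (U ∩ K) ∩ (U ∩ K)).Nonempty}

/-- The almost periodic set `AP(f|K)` of the restriction of `f` to `K`. -/
def almostPeriodicPtsIn {G : Type*} [TopologicalSpace G] (f : G → G) (K : Set G) : Set G :=
  {x | x ∈ K ∧ ∀ U : Set G, IsOpen U → x ∈ U →
    ∃ m : ℕ, 0 < m ∧ ∀ n : ℕ, ∃ i : ℕ, 1 ≤ i ∧ i ≤ m ∧ f^[n + i] x ∈ U}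

/-- The orbit `O(K,f)` of a set `K` under `f`. -/
def setOrbit {G : Type*} (f : G → G) (K : Set G) : Set G := ⋃ i : ℕ, f^[i] '' K

/-- The orbit segment `O_n(K,f)`. -/
def setOrbitSeg {G : Type*} (f : G → G) (K : Set G) (n : ℕ) : Set G :=
  ⋃ i ≤ n, f^[i] '' K

/-- The inverse orbit (absorbed set) `O₋(K,f)`. -/
def invOrbit {G : Type*} (f : G → G) (K : Set G) : Set G := ⋃ i : ℕ, f^[i] ⁻¹' K

/-- The main absorbed set `Ab(K,f)`: the union of the connected components of `O₋(K,f)`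
that meet `K`. -/
def mainAbsorbed {G : Type*} [TopologicalSpace G] (f : G → G) (K : Set G) : Set G :=
  ⋃ x ∈ K, connectedComponentIn (invOrbit f K) x

/-- A minimal set of `f`: nonempty, closed, invariant, with no proper such subset. -/
def IsMinimalSet {G : Type*} [TopologicalSpace G] (f : G → G) (M : Set G) : Prop :=
  M.Nonempty ∧ IsClosed M ∧ f '' M ⊆ M ∧
    ∀ N : Set G, N ⊆ M → N.Nonempty → IsClosed N → f '' N ⊆ N → N = M

open Classical in
/-- The valence of a point `x` in a metric space: the limit, as `r → 0⁺`, of the number of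
boundary points of the ball `B(x,r)` (defined as the eventual value, if it exists). -/
def valence {G : Type*} [MetricSpace G] (x : G) : ℕ :=
  if h : ∃ n : ℕ, ∀ᶠ r in nhdsWithin (0 : ℝ) (Set.Ioi 0),
      (frontier (Metric.ball x r)).ncard = n
  then h.choose else 0

/-- The set of branching points. -/
def branchPts (G : Type*) [MetricSpace G] : Set G := {x | 2 < valence x}

/-- The total branching number `ξ(U)` of a subset `U` of `G`. -/
def totalBranch {G : Type*} [MetricSpace G] (U : Set G) : ℕ :=
  ∑ᶠ v ∈ U ∩ branchPts G, (valence v - 2)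

/-- Cyclic successor on `Fin k`. -/
def finSucc {k : ℕ} (i : Fin k) : Fin k := ⟨(i.1 + 1) % k, Nat.mod_lt _ i.pos⟩

/-- `C : Fin k → Set G` enumerates the connected components of `X`, and `f` maps each
component into the (cyclically) next one. -/
def IsCyclicDecomp {G : Type*} [TopologicalSpace G] (f : G → G) (X : Set G)
    {k : ℕ} (C : Fin k → Set G) : Prop :=
  (⋃ i, C i) = X ∧ (∀ i, (C i).Nonempty) ∧
  (∀ i, ∀ x ∈ C i, connectedComponentIn X x = C i) ∧
  Function.Injective C ∧ ∀ i, f '' C i ⊆ C (finSucc i)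

/-- A component-cyclic `f`-invariant set. -/
def ComponentCyclic {G : Type*} [TopologicalSpace G] (f : G → G) (X : Set G) : Prop :=
  ∃ (k : ℕ) (C : Fin k → Set G), 0 < k ∧ IsCyclicDecomp f X C

/-- `A` is a connected component of `S`. -/
def IsCompOf {G : Type*} [TopologicalSpace G] (A S : Set G) : Prop :=
  ∃ x ∈ S, connectedComponentIn S x = A

/-- The distance between two sets. -/
def setDist {G : Type*} [MetricSpace G] (A B : Set G) : ℝ :=
  sInf {r : ℝ | ∃ a ∈ A, ∃ b ∈ B, dist a b = r}

end

section GraphDynamics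

variable {G : Type*}

/-- A prong: an arc parametrised by `[0, 1]` whose interior avoids `V`, such that open
parameter intervals have open images. -/
structure IsProng [TopologicalSpace G] (V : Set G) (γ : ℝ → G) : Prop where
  continuousOn : ContinuousOn γ (Icc 0 1)
  injOn : InjOn γ (Icc 0 1)
  isOpen_image : ∀ s t : ℝ, 0 ≤ s → t ≤ 1 → IsOpen (γ '' Ioo s t)
  notMem : ∀ t ∈ Ioo (0 : ℝ) 1, γ t ∉ V

/-- A star at `p`: a finite set of prongs ending at `p` which together fill neighbourhoods
of `p`. -/
structure IsStar [TopologicalSpace G] (V : Set G) (p : G) (E : Set (ℝ → G)) : Prop where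
  finite : E.Finite
  prong : ∀ γ ∈ E, IsProng V γ
  apply_one : ∀ γ ∈ E, γ 1 = p
  mem_nhds : ∀ a : ℝ, 0 ≤ a → a < 1 → insert p (⋃ γ ∈ E, γ '' Ioo a 1) ∈ 𝓝 p

theorem exists_Ioo_of_eventually_nhdsLT {P : ℝ → Prop} (h : ∀ᶠ t in 𝓝[<] (1 : ℝ), P t) :
    ∃ a : ℝ, 0 ≤ a ∧ a < 1 ∧ ∀ t ∈ Ioo a 1, P t := by
  obtain ⟨l, hl, h⟩ := mem_nhdsLT_iff_exists_Ioo_subset.1 h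
  exact ⟨max l 0, le_max_right _ _, max_lt hl one_pos,
    fun t ht => h ⟨(le_max_left _ _).trans_lt ht.1, ht.2⟩⟩

namespace IsProng

variable [TopologicalSpace G] {V : Set G} {γ : ℝ → G}

theorem tendsto (h : IsProng V γ) : Tendsto γ (𝓝[<] 1) (𝓝 (γ 1)) := by
  have := (h.continuousOn 1 (by simp)).tendsto
  refine this.mono_left ?_
  rw [← nhdsWithin_Ioo_eq_nhdsLT (zero_lt_one' ℝ)]
  exact nhdsWithin_mono _ Ioo_subset_Icc_self

theorem isPreconnected_image (h : IsProng V γ) {s : Set ℝ} (hs : IsPreconnected s)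
    (hs' : s ⊆ Icc 0 1) : IsPreconnected (γ '' s) :=
  hs.image _ (h.continuousOn.mono hs')

theorem subset_of_isPreconnected [T2Space G] (h : IsProng V γ) {S : Set G}
    (hS : IsPreconnected S) {s t : ℝ} (hs : 0 ≤ s) (ht : t ≤ 1) (h1 : γ s ∉ S) (h2 : γ t ∉ S)
    (hne : (S ∩ γ '' Ioo s t).Nonempty) : S ⊆ γ '' Ioo s t := by
  have hc : IsCompact (γ '' Icc s t) :=
    isCompact_Icc.image_of_continuousOn (h.continuousOn.mono (Icc_subset_Icc hs ht))
  refine hS.subset_left_of_subset_union (h.isOpen_image s t hs ht)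
    hc.isClosed.isOpen_compl ?_ ?_ hne
  · exact (disjoint_compl_right (a := γ '' Icc s t)).mono_left (image_mono Ioo_subset_Icc_self)
  · intro x hx
    by_cases hx' : x ∈ γ '' Icc s t
    · obtain ⟨r, hr, rfl⟩ := hx'
      left
      refine ⟨r, ⟨lt_of_le_of_ne hr.1 ?_, lt_of_le_of_ne hr.2 ?_⟩, rfl⟩
      · rintro rfl; exact h1 hx
      · rintro rfl; exact h2 hx
    · exact Or.inr hx'

theorem eventually_notMem (h : IsProng V γ) (x : G) :
    ∀ᶠ a in 𝓝[<] (1 : ℝ), 0 ≤ a ∧ x ∉ γ '' Ioo a 1 := by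
  by_cases hx : ∃ t ∈ Ico (0 : ℝ) 1, γ t = x
  · obtain ⟨t, ht, rfl⟩ := hx
    filter_upwards [Ioo_mem_nhdsLT ht.2] with a ha
    refine ⟨ht.1.trans ha.1.le, ?_⟩
    rintro ⟨r, hr, hrt⟩
    have := h.injOn ⟨(ht.1.trans ha.1.le).trans hr.1.le, hr.2.le⟩ ⟨ht.1, ht.2.le⟩ hrt
    linarith [hr.1, ha.1]
  · filter_upwards [Ioo_mem_nhdsLT (zero_lt_one' ℝ)] with a ha
    refine ⟨ha.1.le, ?_⟩
    rintro ⟨r, hr, hrt⟩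
    exact hx ⟨r, ⟨ha.1.le.trans hr.1.le, hr.2⟩, hrt⟩

/-- A connected set missing the tip of a prong either contains or avoids the end of it. -/
theorem eventually_mem_or_notMem [T2Space G] (h : IsProng V γ) {X : Set G}
    (hX : IsPreconnected X) (hne : X.Nonempty) (h1 : γ 1 ∉ X) :
    (∀ᶠ t in 𝓝[<] (1 : ℝ), γ t ∈ X) ∨ ∀ᶠ t in 𝓝[<] (1 : ℝ), γ t ∉ X := by
  obtain ⟨x, hx⟩ := hne
  by_cases hd : ∃ t, 0 ≤ t ∧ t < 1 ∧ ∀ s ∈ Ioo t 1, γ s ∉ X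
  · obtain ⟨t, -, ht, hd⟩ := hd
    right
    filter_upwards [Ioo_mem_nhdsLT ht] with s hs using hd s hs
  · left
    push Not at hd
    filter_upwards [h.eventually_notMem x, self_mem_nhdsWithin] with s hs hs1
    by_contra hsX
    obtain ⟨r, hr, hrX⟩ := hd s hs.1 hs1
    exact hs.2 (h.subset_of_isPreconnected hX hs.1 le_rfl hsX h1 ⟨γ r, hrX, r, hr, rfl⟩ hx)

/-- The parameter of a point of a prong. -/
noncomputable def param (γ : ℝ → G) : G → ℝ := Function.invFunOn γ (Ioo 0 1)

theorem param_apply (h : IsProng V γ) {t : ℝ} (ht : t ∈ Ioo (0 : ℝ) 1) : param γ (γ t) = t :=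
  (h.injOn.mono Ioo_subset_Icc_self).leftInvOn_invFunOn ht

theorem continuousOn_param (h : IsProng V γ) : ContinuousOn (param γ) (γ '' Ioo 0 1) := by
  rintro _ ⟨t, ht, rfl⟩
  refine ContinuousAt.continuousWithinAt ?_
  rw [ContinuousAt, h.param_apply ht, tendsto_order]
  constructor
  · intro a ha
    filter_upwards [(h.isOpen_image (max a 0) 1 (le_max_right _ _) le_rfl).mem_nhds
      ⟨t, ⟨max_lt ha ht.1, ht.2⟩, rfl⟩]
    rintro _ ⟨r, hr, rfl⟩
    rw [h.param_apply ⟨(le_max_right _ _).trans_lt hr.1, hr.2⟩]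
    exact (le_max_left _ _).trans_lt hr.1
  · intro a ha
    filter_upwards [(h.isOpen_image 0 (min a 1) le_rfl (min_le_right _ _)).mem_nhds
      ⟨t, ⟨ht.1, lt_min ha ht.2⟩, rfl⟩]
    rintro _ ⟨r, hr, rfl⟩
    rw [h.param_apply ⟨hr.1, hr.2.trans_le (min_le_right _ _)⟩]
    exact hr.2.trans_le (min_le_left _ _)

/-- A self-map of a prong end without fixed points there which moves one point forwards moves
all points forwards. -/
theorem forall_lt_of_exists_lt (h : IsProng V γ) {f : G → G} (hf : Continuous f) {a : ℝ}
    (ha : 0 ≤ a) (hmap : ∀ t ∈ Ioo a 1, f (γ t) ∈ γ '' Ioo 0 1)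
    (hfix : ∀ t ∈ Ioo a 1, f (γ t) ≠ γ t)
    (hex : ∃ t ∈ Ioo a 1, ∃ s ∈ Ioo t 1, f (γ t) = γ s) :
    ∀ t ∈ Ioo a 1, ∃ s ∈ Ioo t 1, f (γ t) = γ s := by
  have hsub : Ioo a 1 ⊆ Icc 0 1 := fun t ht => ⟨ha.trans ht.1.le, ht.2.le⟩
  have hc : ContinuousOn (fun t => param γ (f (γ t))) (Ioo a 1) :=
    h.continuousOn_param.comp (hf.comp_continuousOn (h.continuousOn.mono hsub)) hmap
  obtain ⟨t₀, ht₀, s₀, hs₀, hts⟩ := hex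
  intro t ht
  obtain ⟨s, hs, hst⟩ := hmap t ht
  rcases lt_or_ge t s with hlt | hle
  · exact ⟨s, ⟨hlt, hs.2⟩, hst.symm⟩
  · have e1 : param γ (f (γ t)) = s := by rw [← hst, h.param_apply hs]
    have e2 : param γ (f (γ t₀)) = s₀ := by
      rw [hts, h.param_apply ⟨(ha.trans ht₀.1.le).trans_lt hs₀.1, hs₀.2⟩]
    obtain ⟨r, hr, hrr⟩ := isPreconnected_Ioo.intermediate_value₂ ht ht₀ hc continuousOn_id
      (by rw [e1]; exact hle) (by rw [e2]; exact hs₀.1.le)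
    obtain ⟨q, hq, hqr⟩ := hmap r hr
    refine absurd ?_ (hfix r hr)
    simp only [id] at hrr
    rw [← hqr, h.param_apply hq] at hrr
    rw [← hqr, hrr]

end IsProng

/-- An interval map moving all points forwards pushes everything to the right end uniformly. -/
theorem exists_lt_iterate {h : ℝ → ℝ} {a : ℝ} (hc : ContinuousOn h (Ioo a 1))
    (hh : ∀ t ∈ Ioo a 1, t < h t ∧ h t < 1) {b c : ℝ} (hb : b ∈ Ioo a 1) (hc1 : c < 1) :
    ∃ J : ℕ, ∀ j ≥ J, ∀ t ∈ Ico b 1, h^[j] t ∈ Ioo c 1 := by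
  wlog hbc : b ≤ c generalizing c
  · obtain ⟨J, hJ⟩ := this hb.2 le_rfl
    exact ⟨J, fun j hj t ht => ⟨(not_le.1 hbc).trans (hJ j hj t ht).1, (hJ j hj t ht).2⟩⟩
  have hsub : Icc b c ⊆ Ioo a 1 := fun t ht => ⟨hb.1.trans_le ht.1, ht.2.trans_lt hc1⟩
  obtain ⟨m, hm, hmin⟩ := isCompact_Icc.exists_isMinOn (nonempty_Icc.2 hbc)
    ((hc.mono hsub).sub continuousOn_id)
  have hδ : 0 < h m - m := sub_pos.2 (hh m (hsub hm)).1
  have key : ∀ t ∈ Ico b 1, ∀ j : ℕ, h^[j] t ∈ Ico b 1 ∧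
      (c < h^[j] t ∨ b + j * (h m - m) ≤ h^[j] t) := by
    intro t ht j
    induction j with
    | zero => exact ⟨ht, Or.inr (by simpa using ht.1)⟩
    | succ j ih =>
      rw [Function.iterate_succ_apply']
      set u := h^[j] t with hu
      have hu' := hh u ⟨hb.1.trans_le ih.1.1, ih.1.2⟩
      refine ⟨⟨ih.1.1.trans hu'.1.le, hu'.2⟩, ?_⟩
      rcases lt_or_ge c u with h1 | h1
      · exact Or.inl (h1.trans hu'.1)
      · right
        have h2 := ih.2.resolve_left (not_lt.2 h1)
        have h3 : h m - m ≤ h u - u := hmin ⟨ih.1.1, h1⟩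
        push_cast
        linarith
  obtain ⟨J, hJ⟩ := exists_nat_gt ((c - b) / (h m - m))
  rw [div_lt_iff₀ hδ] at hJ
  refine ⟨J, fun j hj t ht => ⟨?_, (key t ht j).1.2⟩⟩
  rcases (key t ht j).2 with h1 | h1
  · exact h1
  · have : (J : ℝ) * (h m - m) ≤ j * (h m - m) := by gcongr
    linarith

/-- If `f` moves all points of the end of a prong forwards, then iterates push the end
uniformly to its tip. -/
theorem IsProng.exists_iterate_mem [TopologicalSpace G] {V : Set G} {γ : ℝ → G}
    (h : IsProng V γ) {f : G → G} (hf : Continuous f) {a : ℝ} (ha : 0 ≤ a)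
    (hmap : ∀ t ∈ Ioo a 1, ∃ s ∈ Ioo t 1, f (γ t) = γ s) {b c : ℝ} (hb : b ∈ Ioo a 1)
    (hc : c < 1) :
    ∃ J : ℕ, ∀ j ≥ J, ∀ t ∈ Ico b 1, f^[j] (γ t) ∈ γ '' Ioo c 1 := by
  have hsub : Ioo a 1 ⊆ Icc 0 1 := fun t ht => ⟨ha.trans ht.1.le, ht.2.le⟩
  set g : ℝ → ℝ := fun t => param γ (f (γ t)) with hg
  have hgs : ∀ t ∈ Ioo a 1, g t ∈ Ioo t 1 ∧ f (γ t) = γ (g t) := by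
    intro t ht
    obtain ⟨s, hs, hst⟩ := hmap t ht
    have : g t = s := by
      simp only [hg, hst]
      exact h.param_apply ⟨(ha.trans ht.1.le).trans_lt hs.1, hs.2⟩
    rw [this]; exact ⟨hs, hst⟩
  have hgc : ContinuousOn g (Ioo a 1) := by
    refine h.continuousOn_param.comp (hf.comp_continuousOn (h.continuousOn.mono hsub)) ?_
    intro t ht
    obtain ⟨s, hs, hst⟩ := hmap t ht
    exact ⟨s, ⟨(ha.trans ht.1.le).trans_lt hs.1, hs.2⟩, hst.symm⟩
  obtain ⟨J, hJ⟩ := exists_lt_iterate hgc (fun t ht => (hgs t ht).1) hb hc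
  refine ⟨J, fun j hj t ht => ⟨g^[j] t, hJ j hj t ht, ?_⟩⟩
  have key : ∀ j : ℕ, g^[j] t ∈ Ioo a 1 ∧ f^[j] (γ t) = γ (g^[j] t) := by
    intro j
    induction j with
    | zero => exact ⟨⟨hb.1.trans_le ht.1, ht.2⟩, rfl⟩
    | succ j ih =>
      rw [Function.iterate_succ_apply', Function.iterate_succ_apply']
      have := hgs _ ih.1
      refine ⟨⟨ih.1.1.trans this.1.1, this.1.2⟩, ?_⟩
      rw [ih.2, this.2]
  exact (key j).2.symm

theorem eventually_nhdsLT_forall_of_forall {P : ℝ → Prop} {a : ℝ} (ha : a < 1)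
    (h : ∀ t ∈ Ioo a 1, P t) : ∀ᶠ b in 𝓝[<] (1 : ℝ), ∀ t ∈ Ioo b 1, P t := by
  filter_upwards [Ioo_mem_nhdsLT ha] with b hb t ht using h t ⟨hb.1.trans ht.1, ht.2⟩

theorem Set.Infinite.exists_lt_lt {T : Set ℝ} (hT : T.Infinite) :
    ∃ t₁ ∈ T, ∃ t₂ ∈ T, ∃ t₃ ∈ T, t₁ < t₂ ∧ t₂ < t₃ := by
  obtain ⟨S, hST, hS⟩ := hT.exists_subset_card_eq 3
  let e := S.orderIsoOfFin hS
  refine ⟨e 0, hST (e 0).2, e 1, hST (e 1).2, e 2, hST (e 2).2, ?_, ?_⟩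
  · exact_mod_cast e.strictMono (by decide)
  · exact_mod_cast e.strictMono (by decide)

section Stars

variable [MetricSpace G] {V : Set G}

theorem IsStar.locallyConnectedSpace (hstar : ∀ p : G, ∃ E, IsStar V p E) :
    LocallyConnectedSpace G := by
  rw [locallyConnectedSpace_iff_connected_subsets]
  intro p U hU
  obtain ⟨E, hE⟩ := hstar p
  have h1 : ∀ᶠ b in 𝓝[<] (1 : ℝ), ∀ γ ∈ E, ∀ t ∈ Ioo b 1, γ t ∈ U := by
    rw [eventually_all_finite hE.finite]
    intro γ hγ
    have := (hE.prong γ hγ).tendsto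
    rw [hE.apply_one γ hγ] at this
    obtain ⟨a, -, ha, h⟩ := exists_Ioo_of_eventually_nhdsLT (this hU)
    exact eventually_nhdsLT_forall_of_forall ha h
  obtain ⟨b, hb, hb0⟩ := (h1.and (Ioo_mem_nhdsLT (zero_lt_one' ℝ))).exists
  refine ⟨_, hE.mem_nhds b hb0.1.le hb0.2, ?_, ?_⟩
  · have : insert p (⋃ γ ∈ E, γ '' Ioo b 1) = ⋃₀ (insert {p} ((fun γ => γ '' Ioc b 1) '' E)) := by
      ext x
      simp only [mem_insert_iff, mem_iUnion, mem_image, sUnion_insert, sUnion_image, mem_union,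
        mem_singleton_iff, exists_prop]
      constructor
      · rintro (h | ⟨γ, hγ, t, ht, rfl⟩)
        · exact Or.inl h
        · exact Or.inr ⟨γ, hγ, t, ⟨ht.1, ht.2.le⟩, rfl⟩
      · rintro (h | ⟨γ, hγ, t, ht, rfl⟩)
        · exact Or.inl h
        · rcases ht.2.eq_or_lt with rfl | h
          · exact Or.inl (hE.apply_one γ hγ)
          · exact Or.inr ⟨γ, hγ, t, ⟨ht.1, h⟩, rfl⟩
    rw [this]
    refine isPreconnected_sUnion p _ ?_ ?_
    · rintro _ (rfl | ⟨γ, hγ, rfl⟩)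
      · rfl
      · exact ⟨1, ⟨hb0.2, le_rfl⟩, hE.apply_one γ hγ⟩
    · rintro _ (rfl | ⟨γ, hγ, rfl⟩)
      · exact isPreconnected_singleton
      · exact (hE.prong γ hγ).isPreconnected_image isPreconnected_Ioc
          fun t ht => ⟨hb0.1.le.trans ht.1.le, ht.2⟩
  · refine insert_subset (mem_of_mem_nhds hU) ?_
    simp only [iUnion_subset_iff]
    rintro γ hγ _ ⟨t, ht, rfl⟩
    exact hb γ hγ t ht

/-- The boundary points at infinity of a family of connected sets sharing a point are finite
in number. -/
theorem IsStar.finite_boundary [CompactSpace G] (hstar : ∀ p : G, ∃ E, IsStar V p E)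
    {ι : Type*} {S : ι → Set G} {x : G} (hS : ∀ i, IsPreconnected (S i)) (hx : ∀ i, x ∈ S i) :
    (closure (⋃ i, S i) ∩ ⋂ i, closure (S i)ᶜ).Finite := by
  by_contra hinf
  set L := closure (⋃ i, S i) ∩ ⋂ i, closure (S i)ᶜ with hL
  obtain ⟨p, hp⟩ := Set.Infinite.exists_accPt_principal hinf
  obtain ⟨E, hE⟩ := hstar p
  have h1 : ∀ᶠ b in 𝓝[<] (1 : ℝ), ∀ γ ∈ E, 0 ≤ b ∧ x ∉ γ '' Ioo b 1 := by
    rw [eventually_all_finite hE.finite]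
    exact fun γ hγ => (hE.prong γ hγ).eventually_notMem x
  obtain ⟨b, hb, hb0⟩ := (h1.and (Ioo_mem_nhdsLT (zero_lt_one' ℝ))).exists
  have h2 := Set.Infinite.of_accPt (hp.nhds_inter (hE.mem_nhds b hb0.1.le hb0.2))
  have h3 : ∃ γ ∈ E, (γ '' Ioo b 1 ∩ L).Infinite := by
    by_contra! hcon
    refine h2 ?_
    refine ((finite_singleton p).union (hE.finite.biUnion fun γ hγ =>
      hcon γ hγ)).subset ?_
    rintro y ⟨hy | hy, hyL⟩
    · exact Or.inl hy
    · simp only [mem_iUnion] at hy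
      obtain ⟨γ, hγ, hy⟩ := hy
      exact Or.inr (mem_biUnion hγ ⟨hy, hyL⟩)
  obtain ⟨γ, hγ, h3⟩ := h3
  have hpr := hE.prong γ hγ
  have h4 : {t ∈ Ioo b 1 | γ t ∈ L}.Infinite := by
    refine Infinite.of_image γ (h3.mono ?_)
    rintro _ ⟨⟨t, ht, rfl⟩, htL⟩
    exact ⟨t, ⟨ht, htL⟩, rfl⟩
  obtain ⟨t₁, ⟨h1b, h1L⟩, t₂, ⟨h2b, h2L⟩, t₃, ⟨h3b, h3L⟩, h12, h23⟩ := h4.exists_lt_lt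
  obtain ⟨c, hc1, hc2⟩ := exists_between h12
  obtain ⟨d, hd2, hd3⟩ := exists_between h23
  have key : ∀ i, Disjoint (γ '' Ioo c d) (S i) := by
    intro i
    obtain ⟨_, ⟨s₁, hs₁, rfl⟩, hs₁S⟩ := mem_closure_iff.1 (mem_iInter.1 h1L.2 i) _
      (hpr.isOpen_image b c hb0.1.le (by linarith [h2b.2])) ⟨t₁, ⟨h1b.1, hc1⟩, rfl⟩
    obtain ⟨_, ⟨s₃, hs₃, rfl⟩, hs₃S⟩ := mem_closure_iff.1 (mem_iInter.1 h3L.2 i) _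
      (hpr.isOpen_image d 1 (by linarith [h2b.1, hb0.1]) le_rfl) ⟨t₃, ⟨hd3, h3b.2⟩, rfl⟩
    rw [disjoint_left]
    rintro _ ⟨r, hr, rfl⟩ hrS
    obtain ⟨q, hq, hqx⟩ := hpr.subset_of_isPreconnected (hS i) (hb0.1.le.trans hs₁.1.le) hs₃.2.le
      hs₁S hs₃S ⟨γ r, hrS, r, ⟨hs₁.2.trans hr.1, hr.2.trans hs₃.1⟩, rfl⟩ (hx i)
    exact (hb γ hγ).2 ⟨q, ⟨hs₁.1.trans hq.1, hq.2.trans hs₃.2⟩, hqx⟩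
  obtain ⟨y, hy, hyS⟩ := mem_closure_iff.1 h2L.1 _
    (hpr.isOpen_image c d (by linarith [h1b.1, hb0.1]) (by linarith [h3b.2])) ⟨t₂, ⟨hc2, hd2⟩, rfl⟩
  obtain ⟨i, hi⟩ := mem_iUnion.1 hyS
  exact disjoint_left.1 (key i) hy hi

theorem IsStar.finite_closure_diff [CompactSpace G] (hstar : ∀ p : G, ∃ E, IsStar V p E)
    {S : Set G} (hS : IsPreconnected S) : (closure S \ S).Finite := by
  rcases S.eq_empty_or_nonempty with rfl | ⟨x, hx⟩
  · simp
  · refine (IsStar.finite_boundary hstar (S := fun _ : Unit => S) (x := x) (fun _ => hS)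
      (fun _ => hx)).subset ?_
    rintro y ⟨hy, hyS⟩
    simp only [iUnion_const, iInter_const]
    exact ⟨hy, subset_closure hyS⟩

end Stars

theorem mem_periodicPts_of_finite_subset_image {f : G → G} {L : Set G} (hL : L.Finite)
    (h : L ⊆ f '' L) : ∀ p ∈ L, p ∈ periodicPts f ∧ f p ∈ L := by
  have he : L = f '' L := by
    refine eq_of_subset_of_ncard_le h (ncard_image_le hL) (hL.image f)
  have hm : MapsTo f L L := fun p hp => he ▸ mem_image_of_mem f hp
  have hinj : InjOn f L := injOn_of_ncard_image_eq (by rw [← he]) hL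
  intro p hp
  refine ⟨?_, hm hp⟩
  have := hL.to_subtype
  obtain ⟨n, hn, hp'⟩ := (hm.restrict_inj.2 hinj).mem_periodicPts ⟨p, hp⟩
  refine ⟨n, hn, ?_⟩
  have h2 := congrArg Subtype.val (hp' : _ = _)
  rw [hm.iterate_restrict n] at h2
  exact h2

/-- An eventually periodic orbit which stays in `X` yields a periodic point in `X`. -/
theorem exists_periodicPts_of_finite_orbit {f : G → G} {x : G}
    (h : (range fun n : ℕ => f^[n] x).Finite) : ∃ n : ℕ, f^[n] x ∈ periodicPts f := by
  obtain ⟨i, j, hij, he⟩ := Set.Finite.exists_lt_map_eq_of_forall_mem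
    (f := fun n : ℕ => f^[n] x) (fun n => mem_range_self n) h
  refine ⟨i, j - i, by omega, ?_⟩
  change f^[j - i] (f^[i] x) = f^[i] x
  rw [← iterate_add_apply, Nat.sub_add_cancel hij.le]
  exact he.symm

section Attraction

variable {f : G → G} {X : Set G}

theorem mem_periodicPts_of_iterate {m : ℕ} (hm : 0 < m) {x : G}
    (hx : x ∈ periodicPts f^[m]) : x ∈ periodicPts f := by
  obtain ⟨n, hn, hx⟩ := hx
  refine ⟨m * n, Nat.mul_pos hm hn, ?_⟩
  rwa [IsPeriodicPt, ← iterate_mul] at hx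

theorem eventually_iterate_of_forall_iterate {m : ℕ} (hm : 0 < m) (hfX : MapsTo f X X)
    {P : G → Prop} (h : ∀ y ∈ X, ∀ᶠ n in atTop, P ((f^[m])^[n] y)) :
    ∀ y ∈ X, ∀ᶠ n in atTop, P (f^[n] y) := by
  intro y hy
  have h1 : ∀ᶠ n in atTop, ∀ j ∈ Iio m, P ((f^[m])^[n] (f^[j] y)) :=
    (eventually_all_finite (finite_Iio m)).2 fun j _ => h _ (hfX.iterate j hy)
  obtain ⟨N, hN⟩ := eventually_atTop.1 h1
  refine eventually_atTop.2 ⟨m * N, fun n hn => ?_⟩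
  have := hN (n / m) ((Nat.le_div_iff_mul_le hm).2 (by rwa [mul_comm])) (n % m) (Nat.mod_lt n hm)
  rwa [← iterate_mul, ← iterate_add_apply, Nat.div_add_mod] at this

variable [MetricSpace G] {V : Set G} {γ : ℝ → G}

theorem IsProng.exists_ball_notMem (hγ : IsProng V γ) :
    ∃ r > 0, γ 0 ∉ ball (γ 1) r := by
  have h0 : γ 0 ≠ γ 1 := fun h => by
    have := hγ.injOn (by simp) (by simp) h
    norm_num at this
  exact ⟨dist (γ 0) (γ 1), dist_pos.2 h0, by simp⟩

theorem IsProng.tendsto_of_eventually_mem (hγ : IsProng V γ) {u : ℕ → G}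
    (h : ∀ c < (1 : ℝ), ∀ᶠ n in atTop, u n ∈ γ '' Ioo c 1) : Tendsto u atTop (𝓝 (γ 1)) := by
  intro U hU
  obtain ⟨a, -, ha1, ha⟩ := exists_Ioo_of_eventually_nhdsLT (hγ.tendsto hU)
  filter_upwards [h a ha1]
  rintro _ ⟨t, ht, rfl⟩
  exact ha t ht

/-- If all orbits in `X` enter the end of a prong, then the end is pushed to the tip by `f`
itself, and the tip is a fixed point. -/
theorem IsProng.fixed_and_forall_lt (hγ : IsProng V γ) (hf : Continuous f)
    (hfX : MapsTo f X X) (hper : ∀ x ∈ X, x ∉ periodicPts f) (hne : X.Nonempty)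
    (h1 : γ 1 ∉ X) {a : ℝ} (ha : 0 ≤ a) (ha1 : a < 1) (hγX : ∀ t ∈ Ioo a 1, γ t ∈ X)
    (hatt : ∀ c < (1 : ℝ), ∀ y ∈ X, ∀ᶠ n in atTop, f^[n] y ∈ γ '' Ioo c 1) :
    f (γ 1) = γ 1 ∧ ∃ b, a ≤ b ∧ b < 1 ∧ ∀ t ∈ Ioo b 1, ∃ s ∈ Ioo t 1, f (γ t) = γ s := by
  obtain ⟨y, hy⟩ := hne
  have hlim := hγ.tendsto_of_eventually_mem fun c hc => hatt c hc y hy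
  have hfix : f (γ 1) = γ 1 := by
    refine tendsto_nhds_unique ((hf.tendsto _).comp hlim) ?_
    have := (tendsto_add_atTop_iff_nat 1).2 hlim
    refine this.congr fun n => ?_
    rw [iterate_succ_apply', comp_apply]
  refine ⟨hfix, ?_⟩
  obtain ⟨r, hr, hr0⟩ := hγ.exists_ball_notMem
  have hball : ∀ᶠ t in 𝓝[<] (1 : ℝ), f (γ t) ∈ ball (γ 1) r := by
    have := (hf.tendsto (γ 1)).comp hγ.tendsto
    rw [hfix] at this
    exact this (ball_mem_nhds _ hr)
  obtain ⟨b', hb0, hb1, hb⟩ := exists_Ioo_of_eventually_nhdsLT hball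
  set b := max a b' with hbdef
  have hab : a ≤ b := le_max_left _ _
  have hb1' : b < 1 := max_lt ha1 hb1
  refine ⟨b, hab, hb1', ?_⟩
  obtain ⟨N, hN⟩ := eventually_atTop.1 (hatt b hb1' y hy)
  choose! u hu huN using hN
  have hstep : ∀ n ≥ N, f (γ (u n)) = γ (u (n + 1)) := by
    intro n hn
    rw [huN n hn, huN (n + 1) (by omega), iterate_succ_apply']
  have hIoo : ∀ t ∈ Ioo b 1, γ t ∈ X := fun t ht => hγX t ⟨hab.trans_lt ht.1, ht.2⟩
  have hsub : f '' (γ '' Ioo b 1) ⊆ γ '' Ioo 0 1 := by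
    refine hγ.subset_of_isPreconnected ((hγ.isPreconnected_image isPreconnected_Ioo
      fun t ht => ⟨(ha.trans hab).trans ht.1.le, ht.2.le⟩).image f hf.continuousOn) le_rfl le_rfl
      ?_ ?_ ?_
    · rintro ⟨_, ⟨t, ht, rfl⟩, h⟩
      exact hr0 (h ▸ hb t ⟨(le_max_right _ _).trans_lt ht.1, ht.2⟩)
    · rintro ⟨_, ⟨t, ht, rfl⟩, h⟩
      exact h1 (h ▸ hfX (hIoo t ht))
    · refine ⟨f (γ (u N)), ⟨_, ⟨_, hu N le_rfl, rfl⟩, rfl⟩, u (N + 1), ?_, (hstep N le_rfl).symm⟩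
      have := hu (N + 1) (by omega)
      exact ⟨(ha.trans hab).trans_lt this.1, this.2⟩
  refine hγ.forall_lt_of_exists_lt hf (ha.trans hab)
    (fun t ht => hsub ⟨_, ⟨t, ht, rfl⟩, rfl⟩)
    (fun t ht h => hper _ (hIoo t ht) ⟨1, one_pos, h⟩) ?_
  by_contra! hcon
  have hanti : ∀ k, u (N + k) ≤ u N := by
    intro k
    induction k with
    | zero => exact le_rfl
    | succ k ih =>
      refine le_trans ?_ ih
      by_contra! hlt
      exact hcon _ (hu (N + k) (by omega)) _ ⟨hlt, (hu (N + (k + 1)) (by omega)).2⟩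
        (hstep (N + k) (by omega))
  obtain ⟨M, hM⟩ := eventually_atTop.1 (hatt (u N) (hu N le_rfl).2 y hy)
  obtain ⟨t, ht, htM⟩ := hM (N + M) (by omega)
  rw [← huN (N + M) (by omega)] at htM
  have h3 := hu (N + M) (by omega)
  have hb0' : 0 ≤ b := ha.trans hab
  have := hγ.injOn ⟨hb0'.trans ((hu N le_rfl).1.le.trans ht.1.le), ht.2.le⟩
    ⟨hb0'.trans h3.1.le, h3.2.le⟩ htM
  linarith [hanti M, ht.1]

variable [CompactSpace G]

/-- If an iterate of `f` pushes the end of a prong to its tip, then an invariant connected set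
containing the end and no periodic points consists of points attracted by the end. -/
theorem IsStar.subset_iUnion_preimage (hstar : ∀ p : G, ∃ E, IsStar V p E) (hf : Continuous f)
    (hX : IsPreconnected X) (hfX : MapsTo f X X) (hper : ∀ x ∈ X, x ∉ periodicPts f)
    (hγ : IsProng V γ) {a : ℝ} (ha : 0 ≤ a) (ha1 : a < 1) (hγX : ∀ t ∈ Ioo a 1, γ t ∈ X)
    (hmap : ∀ t ∈ Ioo a 1, ∃ s ∈ Ioo t 1, f (γ t) = γ s) :
    X ⊆ ⋃ n : ℕ, f^[n] ⁻¹' (γ '' Ioo a 1) := by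
  have := IsStar.locallyConnectedSpace hstar
  set W := γ '' Ioo a 1 with hW
  set B := ⋃ n : ℕ, f^[n] ⁻¹' W with hB
  have hWo : IsOpen W := hγ.isOpen_image a 1 ha le_rfl
  have hBo : IsOpen B := isOpen_iUnion fun n => hWo.preimage (hf.iterate n)
  have hfW : MapsTo f W W := by
    rintro _ ⟨t, ht, rfl⟩
    obtain ⟨s, hs, hst⟩ := hmap t ht
    exact ⟨s, ⟨ht.1.trans hs.1, hs.2⟩, hst.symm⟩
  have hWB : W ⊆ B := subset_iUnion_of_subset 0 subset_rfl
  have hfB : MapsTo f B B := by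
    intro x hx
    obtain ⟨n, hn⟩ := mem_iUnion.1 hx
    refine mem_iUnion.2 ⟨n, ?_⟩
    rw [mem_preimage, ← iterate_succ_apply, iterate_succ_apply']
    exact hfW hn
  obtain ⟨t₀, ht₀⟩ := exists_between ha1
  have hwW : γ t₀ ∈ W := ⟨t₀, ht₀, rfl⟩
  set A := connectedComponentIn B (γ t₀) with hA
  have hAo : IsOpen A := hBo.connectedComponentIn
  have hAB : A ⊆ B := connectedComponentIn_subset _ _
  have hWA : W ⊆ A := (hγ.isPreconnected_image isPreconnected_Ioo
    fun t ht => ⟨ha.trans ht.1.le, ht.2.le⟩).subset_connectedComponentIn hwW hWB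
  have hfA : MapsTo f A A := by
    have h1 : f (γ t₀) ∈ A := hWA (hfW hwW)
    have h2 : f '' A ⊆ connectedComponentIn B (f (γ t₀)) :=
      (isPreconnected_connectedComponentIn.image f hf.continuousOn).subset_connectedComponentIn
        (mem_image_of_mem f (hWA hwW)) (image_subset_iff.2 fun x hx => hfB (hAB hx))
    rw [← connectedComponentIn_eq h1] at h2
    exact image_subset_iff.1 h2
  refine Subset.trans ?_ hAB
  by_contra hXA
  have hQ : (X ∩ (closure A \ A)).Nonempty := by
    by_contra hemp
    refine hXA (hX.subset_left_of_subset_union hAo isClosed_closure.isOpen_compl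
      (disjoint_compl_right_iff_subset.2 subset_closure) ?_ ⟨γ t₀, hγX t₀ ht₀, hWA hwW⟩)
    intro x hx
    by_cases hxA : x ∈ A
    · exact Or.inl hxA
    · exact Or.inr fun hxc => hemp ⟨x, hx, hxc, hxA⟩
  have hQB : ∀ x ∈ closure A, x ∈ B → x ∈ A := by
    intro x hx hxB
    exact (isPreconnected_connectedComponentIn.subset_closure (subset_insert x A)
      (insert_subset hx subset_closure)).subset_connectedComponentIn
        (mem_insert_of_mem _ (hWA hwW)) (insert_subset hxB hAB) (mem_insert x A)
  have hBf : ∀ x, f x ∈ B → x ∈ B := by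
    intro x hx
    obtain ⟨n, hn⟩ := mem_iUnion.1 hx
    exact mem_iUnion.2 ⟨n + 1, hn⟩
  have hfQ : MapsTo f (X ∩ (closure A \ A)) (X ∩ (closure A \ A)) := by
    rintro x ⟨hxX, hxA, hxA'⟩
    exact ⟨hfX hxX, hfA.closure hf hxA, fun h => hxA' (hQB x hxA (hBf x (hAB h)))⟩
  obtain ⟨q, hq⟩ := hQ
  have hfin : (range fun n : ℕ => f^[n] q).Finite := by
    refine (IsStar.finite_closure_diff hstar
      (isPreconnected_connectedComponentIn (F := B) (x := γ t₀))).subset ?_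
    rintro _ ⟨n, rfl⟩
    exact (hfQ.iterate n hq).2
  obtain ⟨n, hn⟩ := exists_periodicPts_of_finite_orbit hfin
  exact hper _ (hfQ.iterate n hq).1 hn

theorem IsStar.eventually_iterate_mem (hstar : ∀ p : G, ∃ E, IsStar V p E) (hf : Continuous f)
    (hX : IsPreconnected X) (hfX : MapsTo f X X) (hper : ∀ x ∈ X, x ∉ periodicPts f)
    (hγ : IsProng V γ) {a : ℝ} (ha : 0 ≤ a) (ha1 : a < 1) (hγX : ∀ t ∈ Ioo a 1, γ t ∈ X)
    {m : ℕ} (hm : 0 < m) (hmap : ∀ t ∈ Ioo a 1, ∃ s ∈ Ioo t 1, f^[m] (γ t) = γ s) {c : ℝ}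
    (hc : c < 1) : ∀ y ∈ X, ∀ᶠ n in atTop, f^[n] y ∈ γ '' Ioo c 1 := by
  refine eventually_iterate_of_forall_iterate (P := (· ∈ γ '' Ioo c 1)) hm hfX ?_
  intro y hy
  have hsub := IsStar.subset_iUnion_preimage hstar (hf.iterate m) hX (hfX.iterate m)
    (fun x hx h => hper x hx (mem_periodicPts_of_iterate hm h)) hγ ha ha1 hγX hmap hy
  obtain ⟨k, t, ht, hk⟩ := mem_iUnion.1 hsub
  obtain ⟨J, hJ⟩ := hγ.exists_iterate_mem (hf.iterate m) ha hmap ht hc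
  refine eventually_atTop.2 ⟨J + k, fun n hn => ?_⟩
  have := hJ (n - k) (by omega) t ⟨le_rfl, ht.2⟩
  rwa [hk, ← iterate_add_apply, Nat.sub_add_cancel (by omega)] at this

end Attraction

section Orbit

variable {f : G → G} {K : Set G}

theorem setOrbitSeg_mono : Monotone (setOrbitSeg f K) := fun _ _ h =>
  biUnion_subset_biUnion_left fun _ hi => le_trans hi h

theorem iterate_mem_setOrbitSeg {z : G} (hz : z ∈ K) {i n : ℕ} (h : i ≤ n) :
    f^[i] z ∈ setOrbitSeg f K n :=
  mem_iUnion₂.2 ⟨i, h, z, hz, rfl⟩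

theorem mem_setOrbitSeg {x : G} {n : ℕ} : x ∈ setOrbitSeg f K n ↔ ∃ i ≤ n, ∃ z ∈ K, f^[i] z = x := by
  simp [setOrbitSeg]

theorem mem_setOrbit {x : G} : x ∈ setOrbit f K ↔ ∃ i, ∃ z ∈ K, f^[i] z = x := by
  simp [setOrbit]

theorem setOrbitSeg_subset (n : ℕ) : setOrbitSeg f K n ⊆ setOrbit f K := by
  intro x hx
  obtain ⟨i, -, h⟩ := mem_setOrbitSeg.1 hx
  exact mem_setOrbit.2 ⟨i, h⟩

theorem iUnion_setOrbitSeg : ⋃ n, setOrbitSeg f K n = setOrbit f K := by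
  refine (iUnion_subset setOrbitSeg_subset).antisymm fun x hx => ?_
  obtain ⟨i, z, hz, rfl⟩ := mem_setOrbit.1 hx
  exact mem_iUnion.2 ⟨i, iterate_mem_setOrbitSeg hz le_rfl⟩

theorem subset_setOrbitSeg (n : ℕ) : K ⊆ setOrbitSeg f K n := fun _ hz =>
  iterate_mem_setOrbitSeg (i := 0) hz n.zero_le

theorem subset_setOrbit : K ⊆ setOrbit f K := (subset_setOrbitSeg 0).trans (setOrbitSeg_subset 0)

theorem mapsTo_setOrbit : MapsTo f (setOrbit f K) (setOrbit f K) := by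
  intro x hx
  obtain ⟨i, z, hz, rfl⟩ := mem_setOrbit.1 hx
  exact mem_setOrbit.2 ⟨i + 1, z, hz, iterate_succ_apply' f i z⟩

theorem iterate_mem_setOrbitSeg_add {x : G} {n : ℕ} (k : ℕ) (hx : x ∈ setOrbitSeg f K n) :
    f^[k] x ∈ setOrbitSeg f K (n + k) := by
  obtain ⟨i, hi, z, hz, rfl⟩ := mem_setOrbitSeg.1 hx
  exact mem_setOrbitSeg.2 ⟨k + i, by omega, z, hz, iterate_add_apply f k i z⟩

theorem diff_setOrbitSeg_succ_subset (n : ℕ) :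
    setOrbit f K \ setOrbitSeg f K (n + 1) ⊆ f '' (setOrbit f K \ setOrbitSeg f K n) := by
  rintro x ⟨hx, hxn⟩
  obtain ⟨i, z, hz, rfl⟩ := mem_setOrbit.1 hx
  rcases i with _ | i
  · exact absurd (subset_setOrbitSeg _ hz) hxn
  · rw [iterate_succ_apply'] at hxn ⊢
    refine ⟨_, ⟨mem_setOrbit.2 ⟨i, z, hz, rfl⟩, fun h => hxn ?_⟩, rfl⟩
    exact iterate_mem_setOrbitSeg_add 1 h

theorem isPreconnected_setOrbitSeg [TopologicalSpace G] (hf : Continuous f)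
    (hK : IsPreconnected K) (hmeet : (f '' K ∩ K).Nonempty) (n : ℕ) :
    IsPreconnected (setOrbitSeg f K n) := by
  obtain ⟨_, ⟨k, hk, rfl⟩, hfk⟩ := hmeet
  induction n with
  | zero =>
    have : setOrbitSeg f K 0 = K := by ext; simp [setOrbitSeg]
    rwa [this]
  | succ n ih =>
    have : setOrbitSeg f K (n + 1) = setOrbitSeg f K n ∪ f^[n + 1] '' K := by
      rw [setOrbitSeg, setOrbitSeg, biUnion_le_succ (fun i => f^[i] '' K)]
    rw [this]
    refine ih.union (f^[n + 1] k) ?_ ⟨k, hk, rfl⟩ (hK.image _ (hf.iterate _).continuousOn)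
    exact iterate_mem_setOrbitSeg hfk le_rfl

theorem isPreconnected_setOrbit [TopologicalSpace G] (hf : Continuous f)
    (hK : IsPreconnected K) (hmeet : (f '' K ∩ K).Nonempty) : IsPreconnected (setOrbit f K) := by
  obtain ⟨x, -, hx⟩ := id hmeet
  rw [← iUnion_setOrbitSeg]
  exact isPreconnected_iUnion ⟨x, mem_iInter.2 fun n => subset_setOrbitSeg n hx⟩
    (isPreconnected_setOrbitSeg hf hK hmeet)

theorem isClosed_setOrbitSeg [TopologicalSpace G] [CompactSpace G] [T2Space G]
    (hf : Continuous f) (hK : IsClosed K) (n : ℕ) : IsClosed (setOrbitSeg f K n) :=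
  (finite_le_nat n).isClosed_biUnion fun i _ => (hK.isCompact.image (hf.iterate i)).isClosed

variable [MetricSpace G] [CompactSpace G] {V : Set G}

/-- The points approached by the orbit segments of `K` without being captured. -/
theorem iInter_closure_diff_setOrbitSeg (hstar : ∀ p : G, ∃ E, IsStar V p E)
    (hf : Continuous f) (hK : IsPreconnected K) (hKc : IsClosed K)
    (hmeet : (f '' K ∩ K).Nonempty)
    (hgrow : ∀ n, (setOrbit f K \ setOrbitSeg f K n).Nonempty)
    (hper : ∀ x ∈ setOrbit f K, x ∉ periodicPts f) :
    ⋂ n, closure (setOrbit f K \ setOrbitSeg f K n) = closure (setOrbit f K) \ setOrbit f K ∧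
    (closure (setOrbit f K) \ setOrbit f K).Nonempty ∧
    ∀ p ∈ closure (setOrbit f K) \ setOrbit f K, f p ∈ closure (setOrbit f K) \ setOrbit f K := by
  obtain ⟨x, -, hx⟩ := id hmeet
  set X := setOrbit f K with hX
  set T : ℕ → Set G := fun n => X \ setOrbitSeg f K n with hT
  have hTanti : Antitone T := fun m n h => sdiff_subset_sdiff_right (setOrbitSeg_mono h)
  set L := ⋂ n, closure (T n) with hL
  have hdir : Directed (· ⊇ ·) fun n => closure (T n) :=
    Antitone.directed_ge fun m n h => closure_mono (hTanti h)
  have hfin : L.Finite := by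
    refine (IsStar.finite_boundary hstar (isPreconnected_setOrbitSeg hf hK hmeet)
      fun n => subset_setOrbitSeg n hx).subset (subset_inter ?_ ?_)
    · rw [iUnion_setOrbitSeg]
      exact (iInter_subset _ 0).trans (closure_mono sdiff_subset)
    · exact iInter_mono fun n => closure_mono fun y hy => hy.2
  have hLf : L ⊆ f '' L := by
    intro y hy
    have hne : (⋂ n, closure (T n) ∩ f ⁻¹' {y}).Nonempty := by
      refine IsCompact.nonempty_iInter_of_directed_nonempty_isCompact_isClosed _
        (Antitone.directed_ge fun m n h => inter_subset_inter_left _ (closure_mono (hTanti h)))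
        (fun n => ?_) (fun n => ?_) (fun n => ?_)
      · have h1 : closure (T (n + 1)) ⊆ f '' closure (T n) :=
          closure_minimal ((diff_setOrbitSeg_succ_subset n).trans (image_mono subset_closure))
            (isClosed_closure.isCompact.image hf).isClosed
        obtain ⟨z, hz, hzy⟩ := h1 (mem_iInter.1 hy (n + 1))
        exact ⟨z, hz, hzy⟩
      · exact (isClosed_closure.inter (isClosed_singleton.preimage hf)).isCompact
      · exact isClosed_closure.inter (isClosed_singleton.preimage hf)
    obtain ⟨z, hz⟩ := hne
    exact ⟨z, mem_iInter.2 fun n => (mem_iInter.1 hz n).1, (mem_iInter.1 hz 0).2⟩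
  have hLp := mem_periodicPts_of_finite_subset_image hfin hLf
  have heq : L = closure X \ X := by
    refine Subset.antisymm (fun y hy => ⟨?_, fun hyX => hper y hyX (hLp y hy).1⟩) ?_
    · exact closure_mono sdiff_subset (mem_iInter.1 hy 0)
    · rintro y ⟨hy, hyX⟩
      refine mem_iInter.2 fun n => ?_
      have hun : X ⊆ T n ∪ setOrbitSeg f K n := fun x hx =>
        (em (x ∈ setOrbitSeg f K n)).elim Or.inr fun h => Or.inl ⟨hx, h⟩
      have hy' := closure_mono hun hy
      rw [closure_union, (isClosed_setOrbitSeg hf hKc n).closure_eq] at hy'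
      exact hy'.resolve_right fun h => hyX (setOrbitSeg_subset n h)
  refine ⟨heq, ?_, fun p hp => ?_⟩
  · rw [← heq]
    exact IsCompact.nonempty_iInter_of_directed_nonempty_isCompact_isClosed _ hdir
      (fun n => (hgrow n).closure) (fun n => isClosed_closure.isCompact) fun n => isClosed_closure
  · rw [← heq] at hp ⊢
    exact (hLp p hp).2

/-- Every point approached by the orbit without being captured lies in the orbit of the tip of
a prong whose end is pushed to the tip by an iterate of `f`. -/
theorem exists_prong_returning (hstar : ∀ p : G, ∃ E, IsStar V p E)
    (hf : Continuous f) (hK : IsPreconnected K) (hKc : IsClosed K)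
    (hmeet : (f '' K ∩ K).Nonempty)
    (hgrow : ∀ n, (setOrbit f K \ setOrbitSeg f K n).Nonempty)
    (hper : ∀ x ∈ setOrbit f K, x ∉ periodicPts f) {v : G}
    (hv : v ∈ closure (setOrbit f K) \ setOrbit f K) :
    ∃ γ, IsProng V γ ∧ γ 1 ∉ setOrbit f K ∧ (∃ k, f^[k] (γ 1) = v) ∧ ∃ m, 0 < m ∧ ∃ a : ℝ,
      0 ≤ a ∧ a < 1 ∧ (∀ t ∈ Ioo a 1, γ t ∈ setOrbit f K) ∧
      ∀ t ∈ Ioo a 1, ∃ s ∈ Ioo t 1, f^[m] (γ t) = γ s := by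
  obtain ⟨hLeq, -, hLf⟩ :=
    iInter_closure_diff_setOrbitSeg hstar hf hK hKc hmeet hgrow hper
  have hXc := isPreconnected_setOrbit hf hK hmeet
  have hSc := isPreconnected_setOrbitSeg hf hK hmeet
  have hLfin := IsStar.finite_closure_diff hstar hXc
  obtain ⟨x₀, -, hx₀⟩ := id hmeet
  set X := setOrbit f K with hX
  set L := closure X \ X with hL
  have hLfk : ∀ k, ∀ p ∈ L, f^[k] p ∈ L := fun k p hp => MapsTo.iterate hLf k hp
  choose E hE using hstar
  set 𝓔 : Set (ℝ → G) := ⋃ p ∈ L, E p with h𝓔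
  have h𝓔fin : 𝓔.Finite := hLfin.biUnion fun p _ => (hE p).finite
  have hpr : ∀ γ ∈ 𝓔, IsProng V γ ∧ γ 1 ∈ L := by
    intro γ hγ
    obtain ⟨p, hp, hγp⟩ := mem_iUnion₂.1 hγ
    exact ⟨(hE p).prong γ hγp, by rwa [(hE p).apply_one γ hγp]⟩
  obtain ⟨r, hr, hrL, hr𝓔⟩ : ∃ r > 0, (∀ p ∈ L, ∀ q ∈ L, p ≠ q → 2 * r ≤ dist p q) ∧
      ∀ γ ∈ 𝓔, γ 0 ∉ ball (γ 1) r := by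
    have h1 : ∀ᶠ r in 𝓝[>] (0 : ℝ), ∀ p ∈ L, ∀ q ∈ L, p ≠ q → 2 * r ≤ dist p q := by
      refine (eventually_all_finite hLfin).2 fun p _ => (eventually_all_finite hLfin).2 fun q _ => ?_
      by_cases hpq : p = q
      · exact Eventually.of_forall fun _ h => absurd hpq h
      · filter_upwards [Ioo_mem_nhdsGT (half_pos (dist_pos.2 hpq))] with r hr _
        linarith [hr.2]
    have h2 : ∀ᶠ r in 𝓝[>] (0 : ℝ), ∀ γ ∈ 𝓔, γ 0 ∉ ball (γ 1) r := by
      refine (eventually_all_finite h𝓔fin).2 fun γ hγ => ?_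
      obtain ⟨r₀, hr₀, h⟩ := (hpr γ hγ).1.exists_ball_notMem
      filter_upwards [Ioo_mem_nhdsGT hr₀] with r hr hmem using h (ball_subset_ball hr.2.le hmem)
    obtain ⟨r, ⟨hr1, hr2⟩, hr⟩ := ((h1.and h2).and self_mem_nhdsWithin).exists
    exact ⟨r, hr, hr1, hr2⟩
  have hball : ∀ p ∈ L, ∀ q ∈ L, ∀ x, x ∈ ball p r → x ∈ ball q r → p = q := by
    intro p hp q hq x hxp hxq
    by_contra hne
    have := hrL p hp q hq hne
    have h3 := dist_triangle_left p q x
    rw [mem_ball] at hxp hxq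
    linarith
  set M := 𝓔.ncard with hM
  obtain ⟨a, ha, ha01⟩ : ∃ a : ℝ, (∀ γ ∈ 𝓔,
      (∀ m ∈ Iic M, ∀ t ∈ Ioo a 1, f^[m] (γ t) ∈ ball (f^[m] (γ 1)) r) ∧
      x₀ ∉ γ '' Ioo a 1 ∧
      ((∀ t ∈ Ioo a 1, γ t ∈ X) ∨ ∀ t ∈ Ioo a 1, γ t ∉ X)) ∧ a ∈ Ioo 0 1 := by
    refine Eventually.exists (f := 𝓝[<] (1 : ℝ))
      (((eventually_all_finite h𝓔fin).2 fun γ hγ => ?_).and (Ioo_mem_nhdsLT one_pos))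
    have hγ1 := (hpr γ hγ).1
    refine Eventually.and ?_ (Eventually.and ?_ ?_)
    · refine (eventually_all_finite (finite_Iic M)).2 fun m _ => ?_
      obtain ⟨a, -, ha1, h⟩ := exists_Ioo_of_eventually_nhdsLT
        ((((hf.iterate m).tendsto (γ 1)).comp hγ1.tendsto) (ball_mem_nhds _ hr))
      exact eventually_nhdsLT_forall_of_forall ha1 h
    · exact (hγ1.eventually_notMem x₀).mono fun _ h => h.2
    · rcases hγ1.eventually_mem_or_notMem hXc ⟨x₀, subset_setOrbit hx₀⟩ (hpr γ hγ).2.2 with h | h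
      · obtain ⟨a, -, ha1, h⟩ := exists_Ioo_of_eventually_nhdsLT h
        exact (eventually_nhdsLT_forall_of_forall ha1 h).mono fun _ h => Or.inl h
      · obtain ⟨a, -, ha1, h⟩ := exists_Ioo_of_eventually_nhdsLT h
        exact (eventually_nhdsLT_forall_of_forall ha1 h).mono fun _ h => Or.inr h
  have hN : ∃ n, closure (X \ setOrbitSeg f K n) ⊆ L ∪ ⋃ γ ∈ 𝓔, γ '' Ioo a 1 := by
    refine exists_subset_nhds_of_isCompact (Antitone.directed_ge fun m n h =>
      closure_mono (sdiff_subset_sdiff_right (setOrbitSeg_mono h)))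
      (fun n => isClosed_closure.isCompact) fun p hp => ?_
    rw [hLeq] at hp
    refine mem_of_superset ((hE p).mem_nhds a ha01.1.le ha01.2) (insert_subset (Or.inl hp) ?_)
    exact iUnion₂_subset fun γ hγ x hx =>
      Or.inr (mem_iUnion₂.2 ⟨γ, mem_iUnion₂.2 ⟨p, hp, hγ⟩, hx⟩)
  obtain ⟨n₀, hn₀⟩ := hN
  have hend : ∀ x ∈ X, x ∉ setOrbitSeg f K n₀ → ∃ γ ∈ 𝓔, ∃ t ∈ Ioo a 1, γ t = x := by
    intro x hx hxn
    rcases hn₀ (subset_closure ⟨hx, hxn⟩) with h | h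
    · exact absurd hx h.2
    · obtain ⟨γ, hγ, t, ht⟩ := mem_iUnion₂.1 h
      exact ⟨γ, hγ, t, ht⟩
  obtain ⟨y, ⟨hyX, hyn⟩, hyv⟩ : ∃ y ∈ X \ setOrbitSeg f K (n₀ + M), y ∈ ball v r := by
    rw [← hLeq] at hv
    obtain ⟨y, hy, h⟩ := Metric.mem_closure_iff.1 (mem_iInter.1 hv (n₀ + M)) r hr
    exact ⟨y, hy, by rwa [mem_ball, dist_comm]⟩
  obtain ⟨s, ⟨z, hz, hzy⟩, hsmin⟩ :
      ∃ s, (∃ z ∈ K, f^[s] z = y) ∧ ∀ i < s, ¬ ∃ z ∈ K, f^[i] z = y := by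
    classical
    have hex := mem_setOrbit.1 hyX
    exact ⟨Nat.find hex, Nat.find_spec hex, fun i hi => Nat.find_min hex hi⟩
  have hsn : n₀ + M < s := by
    by_contra! hle
    exact hyn (mem_setOrbitSeg.2 ⟨s, hle, z, hz, hzy⟩)
  have hfresh : ∀ i j, i < j → j ≤ s → f^[j] z ∉ setOrbitSeg f K i := by
    intro i j hij hjs hmem
    have h1 := iterate_mem_setOrbitSeg_add (s - j) hmem
    rw [← iterate_add_apply, Nat.sub_add_cancel hjs, hzy] at h1
    obtain ⟨l, hl, h2⟩ := mem_setOrbitSeg.1 h1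
    exact hsmin l (by omega) h2
  have hzX : ∀ j, f^[j] z ∈ X := fun j => mem_setOrbit.2 ⟨j, z, hz, rfl⟩
  have hchain : ∀ j ∈ Icc (s - M) s, ∃ γ ∈ 𝓔, ∃ t ∈ Ioo a 1, γ t = f^[j] z := fun j hj =>
    hend _ (hzX j) (hfresh n₀ j (by have := hj.1; omega) hj.2)
  have : Nonempty G := ⟨x₀⟩
  choose! Γ hΓ τ hτ hΓτ using hchain
  obtain ⟨i, hi, j, hj, hij, hΓij⟩ : ∃ i ∈ Icc (s - M) s, ∃ j ∈ Icc (s - M) s,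
      i < j ∧ Γ i = Γ j := by
    have hcard : 𝓔.ncard < (Icc (s - M) s).ncard := by
      rw [← Finset.coe_Icc, ncard_coe_finset, Nat.card_Icc]
      omega
    obtain ⟨i, hi, j, hj, hne, h⟩ :=
      exists_ne_map_eq_of_ncard_lt_of_maps_to hcard hΓ h𝓔fin
    rcases hne.lt_or_gt with h1 | h1
    · exact ⟨i, hi, j, hj, h1, h⟩
    · exact ⟨j, hj, i, hi, h1, h.symm⟩
  set γ := Γ i with hγ
  have hγ𝓔 : γ ∈ 𝓔 := hΓ i hi
  obtain ⟨hγp, hγL⟩ := hpr γ hγ𝓔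
  obtain ⟨haball, hax₀, haX⟩ := ha γ hγ𝓔
  have hti := hτ i hi
  have htj := hτ j hj
  have hzi : γ (τ i) = f^[i] z := hΓτ i hi
  have hzj : γ (τ j) = f^[j] z := by rw [hΓij]; exact hΓτ j hj
  have hγX : ∀ t ∈ Ioo a 1, γ t ∈ X :=
    haX.resolve_right fun h => h (τ i) hti (by rw [hzi]; exact hzX i)
  have hstep : f^[j - i] (γ (τ i)) = γ (τ j) := by
    rw [hzi, hzj, ← iterate_add_apply, Nat.sub_add_cancel hij.le]
  have hjiM : j - i ∈ Iic M := by
    have := hi.1; have := hj.2; rw [mem_Iic]; omega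
  have hpfix : f^[j - i] (γ 1) = γ 1 :=
    hball _ (hLfk _ _ hγL) _ hγL (γ (τ j)) (hstep ▸ haball _ hjiM _ hti)
      (haball 0 (Nat.zero_le M) _ htj)
  refine ⟨γ, hγp, hγL.2, ⟨s - i, ?_⟩, j - i, by omega, a, ha01.1.le, ha01.2, hγX, ?_⟩
  · refine hball _ (hLfk _ _ hγL) v hv y ?_ hyv
    have h1 := haball (s - i) (by have := hi.1; rw [mem_Iic]; omega) _ hti
    rwa [hzi, ← iterate_add_apply, Nat.sub_add_cancel hi.2, hzy] at h1
  have hlt : τ i < τ j := by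
    have hzi' : γ (τ i) ∈ setOrbitSeg f K i := by
      rw [hzi]; exact iterate_mem_setOrbitSeg hz le_rfl
    have hzj' : γ (τ j) ∉ setOrbitSeg f K i := by
      rw [hzj]; exact hfresh i j hij hj.2
    by_contra! hle
    rcases hle.eq_or_lt with heq | hlt
    · exact hzj' (heq ▸ hzi')
    · obtain ⟨q, hq, hqx⟩ := hγp.subset_of_isPreconnected (hSc i) (ha01.1.le.trans htj.1.le) le_rfl
        hzj' (fun h => hγL.2 (setOrbitSeg_subset i h)) ⟨_, hzi', _, ⟨hlt, hti.2⟩, rfl⟩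
        (subset_setOrbitSeg i hx₀)
      exact hax₀ ⟨q, ⟨htj.1.trans hq.1, hq.2⟩, hqx⟩
  have hsub : f^[j - i] '' (γ '' Ioo a 1) ⊆ γ '' Ioo 0 1 := by
    refine hγp.subset_of_isPreconnected ((hγp.isPreconnected_image isPreconnected_Ioo
      fun t ht => ⟨ha01.1.le.trans ht.1.le, ht.2.le⟩).image _ (hf.iterate _).continuousOn)
      le_rfl le_rfl ?_ ?_ ?_
    · rintro ⟨_, ⟨t, ht, rfl⟩, h⟩
      refine hr𝓔 γ hγ𝓔 ?_
      have := haball _ hjiM t ht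
      rwa [h, hpfix] at this
    · rintro ⟨_, ⟨t, ht, rfl⟩, h⟩
      refine hγL.2 (h ▸ ?_)
      exact mapsTo_setOrbit.iterate _ (hγX t ht)
    · exact ⟨_, ⟨_, ⟨_, hti, rfl⟩, rfl⟩, τ j, ⟨ha01.1.trans htj.1, htj.2⟩, hstep.symm⟩
  exact hγp.forall_lt_of_exists_lt (hf.iterate _) ha01.1.le
    (fun t ht => hsub ⟨_, ⟨t, ht, rfl⟩, rfl⟩)
    (fun t ht h => hper _ (hγX t ht) ⟨j - i, by omega, h⟩)
    ⟨τ i, hti, τ j, ⟨hlt, htj.2⟩, hstep⟩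

end Orbit

section Edges

theorem isCircle_image [TopologicalSpace G] [T2Space G] {γ : ℝ → G} (hc : ContinuousOn γ (Icc 0 1))
    (hi : InjOn γ (Ico 0 1)) (h01 : γ 0 = γ 1) : IsCircle (γ '' Icc 0 1) := by
  have : Fact ((0 : ℝ) < 1) := ⟨one_pos⟩
  set g : AddCircle (1 : ℝ) → G := AddCircle.liftIco 1 0 γ with hg
  have hgc : Continuous g := AddCircle.liftIco_zero_continuous h01 hc
  have hrep : ∀ x : AddCircle (1 : ℝ), ∃ t ∈ Ico (0 : ℝ) 1, (t : AddCircle (1 : ℝ)) = x := by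
    intro x
    have h := (AddCircle.coe_image_Ico_eq (1 : ℝ) 0).symm ▸ mem_univ x
    simpa using h
  have hgi : Injective g := by
    intro x y hxy
    obtain ⟨s, hs, rfl⟩ := hrep x
    obtain ⟨t, ht, rfl⟩ := hrep y
    rw [hg, AddCircle.liftIco_zero_coe_apply hs, AddCircle.liftIco_zero_coe_apply ht] at hxy
    rw [hi hs ht hxy]
  have hrange : range g = γ '' Icc 0 1 := by
    apply Subset.antisymm
    · rintro _ ⟨x, rfl⟩
      obtain ⟨s, hs, rfl⟩ := hrep x
      rw [hg, AddCircle.liftIco_zero_coe_apply hs]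
      exact ⟨s, Ico_subset_Icc_self hs, rfl⟩
    · rintro _ ⟨t, ht, rfl⟩
      rcases ht.2.eq_or_lt with rfl | h1
      · exact ⟨((0 : ℝ) : AddCircle (1 : ℝ)), by
          rw [hg, AddCircle.liftIco_zero_coe_apply (by simp), h01]⟩
      · exact ⟨(t : AddCircle (1 : ℝ)), by rw [hg, AddCircle.liftIco_zero_coe_apply ⟨ht.1, h1⟩]⟩
  let e₁ : AddCircle (1 : ℝ) ≃ₜ range g := (hgc.isClosedEmbedding hgi).isEmbedding.toHomeomorph
  let e₂ : Circle ≃ₜ sphere (0 : ℂ) 1 := Homeomorph.refl _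
  rw [IsCircle, ← hrange]
  exact ⟨e₁.symm.trans ((AddCircle.homeomorphCircle one_ne_zero).trans e₂)⟩

/-- A path in a compact space whose end accumulates only at finitely many points converges. -/
theorem exists_tendsto_of_mapClusterPt_finite [MetricSpace G] [CompactSpace G] {V : Set G}
    {φ : ℝ → G} (hφ : ContinuousOn φ (Ioo 0 1)) (hV : V.Finite)
    (hcl : ∀ y, MapClusterPt y (𝓝[<] 1) φ → y ∈ V) : ∃ v ∈ V, Tendsto φ (𝓝[<] 1) (𝓝 v) := by
  obtain ⟨v, -, hv⟩ := isCompact_univ.exists_mapClusterPt_of_frequently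
    (l := 𝓝[<] (1 : ℝ)) (f := φ) (Frequently.of_forall fun _ => mem_univ _)
  refine ⟨v, hcl v hv, tendsto_nhds_of_unique_mapClusterPt fun w hw => ?_⟩
  by_contra hne
  have hd : 0 < dist w v := dist_pos.2 hne
  obtain ⟨r, hr, hrV⟩ : ∃ r ∈ Ioo 0 (dist w v), r ∉ (fun y => dist y v) '' V :=
    ((Ioo_infinite hd).sdiff (hV.image fun y => dist y v)).nonempty
  have h1 : ∃ᶠ t in 𝓝[<] (1 : ℝ), dist (φ t) v < r :=
    hv.frequently (ball_mem_nhds v hr.1)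
  have h2 : ∃ᶠ t in 𝓝[<] (1 : ℝ), r < dist (φ t) v :=
    hw.frequently ((isOpen_lt continuous_const (continuous_id.dist continuous_const)).mem_nhds hr.2)
  have h3 : ∃ᶠ t in 𝓝[<] (1 : ℝ), φ t ∈ sphere v r := by
    rw [frequently_iff]
    intro U hU
    obtain ⟨a, ha0, ha1, ha⟩ := exists_Ioo_of_eventually_nhdsLT hU
    obtain ⟨s, hs, hs'⟩ := frequently_iff.1 h1 (Ioo_mem_nhdsLT ha1)
    obtain ⟨t, ht, ht'⟩ := frequently_iff.1 h2 (Ioo_mem_nhdsLT ha1)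
    have hc : ContinuousOn (fun t => dist (φ t) v) (Ioo a 1) :=
      (continuous_id.dist continuous_const).comp_continuousOn (hφ.mono (Ioo_subset_Ioo_left ha0))
    obtain ⟨q, hq, hqr⟩ := isPreconnected_Ioo.intermediate_value hs ht hc ⟨hs'.le, ht'.le⟩
    exact ⟨q, ha q hq, hqr⟩
  obtain ⟨y, hy, hyc⟩ := (isCompact_sphere v r).exists_mapClusterPt_of_frequently h3
  exact hrV ⟨y, hcl y hyc, hy⟩

/-- An edge: a path between vertices whose interior parametrises a component of the complement
of the vertex set. -/
structure IsEdge [TopologicalSpace G] (V : Set G) (φ : ℝ → G) : Prop where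
  continuousOn : ContinuousOn φ (Icc 0 1)
  injOn : InjOn φ (Ioo 0 1)
  notMem : ∀ t ∈ Ioo (0 : ℝ) 1, φ t ∉ V
  zero_mem : φ 0 ∈ V
  one_mem : φ 1 ∈ V
  component : ∀ t ∈ Ioo (0 : ℝ) 1, connectedComponentIn Vᶜ (φ t) = φ '' Ioo 0 1

theorem mapClusterPt_mem_of_component [TopologicalSpace G] {V : Set G} {φ : ℝ → G} {g : G → ℝ}
    {x : G} (hφe : φ '' Ioo 0 1 = connectedComponentIn Vᶜ x)
    (hg : ContinuousOn g (φ '' Ioo 0 1)) (hgφ : ∀ t ∈ Ioo (0 : ℝ) 1, g (φ t) = t) {y : G}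
    (hy : MapClusterPt y (𝓝[<] 1) φ) : y ∈ V := by
  by_contra hyV
  have hye : y ∉ φ '' Ioo 0 1 := by
    rintro ⟨s, hs, rfl⟩
    have h1 : ∀ᶠ z in 𝓝[φ '' Ioo 0 1] (φ s), g z < (s + 1) / 2 := by
      refine (hg _ ⟨s, hs, rfl⟩).tendsto.eventually_lt_const ?_
      rw [hgφ s hs]; linarith [hs.2]
    have h2 := hy.frequently (eventually_nhdsWithin_iff.1 h1)
    obtain ⟨t, ht, h⟩ := frequently_iff.1 h2
      (Ioo_mem_nhdsLT (show (s + 1) / 2 < 1 by linarith [hs.2]))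
    have ht' : t ∈ Ioo (0 : ℝ) 1 := ⟨by linarith [ht.1, hs.1], ht.2⟩
    have := h ⟨t, ht', rfl⟩
    rw [hgφ t ht'] at this
    linarith [ht.1]
  have hyc : y ∈ closure (φ '' Ioo 0 1) := by
    refine mem_closure_iff_clusterPt.2 (ClusterPt.mono hy (le_principal_iff.2 (mem_map.2 ?_)))
    exact mem_of_superset (Ioo_mem_nhdsLT (zero_lt_one' ℝ)) fun t ht => ⟨t, ht, rfl⟩
  have hsub : insert y (φ '' Ioo 0 1) ⊆ Vᶜ := by
    rw [hφe]
    exact insert_subset hyV (connectedComponentIn_subset _ _)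
  have hpre : IsPreconnected (insert y (φ '' Ioo 0 1)) := by
    refine IsPreconnected.subset_closure (hφe ▸ isPreconnected_connectedComponentIn)
      (subset_insert _ _) (insert_subset hyc subset_closure)
  have hx : x ∈ φ '' Ioo 0 1 := by
    rw [hφe]
    refine mem_connectedComponentIn ?_
    by_contra h
    have h1 := hφe ▸ connectedComponentIn_eq_empty h
    exact (nonempty_Ioo.2 (zero_lt_one' ℝ)).image φ |>.ne_empty h1
  have := hpre.subset_connectedComponentIn (mem_insert_of_mem _ hx) hsub (mem_insert _ _)
  rw [← hφe] at this
  exact hye this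

theorem tendsto_one_sub_nhdsGT_zero : Tendsto (fun t : ℝ => 1 - t) (𝓝[>] 0) (𝓝[<] 1) := by
  refine tendsto_nhdsWithin_iff.2 ⟨?_, eventually_nhdsWithin_of_forall fun t ht => ?_⟩
  · have : Tendsto (fun t : ℝ => 1 - t) (𝓝 0) (𝓝 (1 - 0)) :=
      (continuous_const.sub continuous_id).tendsto 0
    rw [sub_zero] at this
    exact this.mono_left nhdsWithin_le_nhds
  · rw [mem_Iio]; linarith [mem_Ioi.1 ht]

theorem one_sub_mem_Ioo {t : ℝ} (ht : t ∈ Ioo (0 : ℝ) 1) : 1 - t ∈ Ioo (0 : ℝ) 1 :=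
  ⟨by linarith [ht.2], by linarith [ht.1]⟩

theorem image_one_sub_Ioo (φ : ℝ → G) : (fun t => φ (1 - t)) '' Ioo 0 1 = φ '' Ioo 0 1 := by
  ext x
  constructor
  · rintro ⟨t, ht, rfl⟩
    exact ⟨1 - t, one_sub_mem_Ioo ht, rfl⟩
  · rintro ⟨t, ht, rfl⟩
    exact ⟨1 - t, one_sub_mem_Ioo ht, by simp⟩

theorem exists_isEdge [MetricSpace G] [CompactSpace G] {V : Set G} (hV : V.Finite)
    (hcomp : ∀ x ∈ Vᶜ, IsOpenArc (connectedComponentIn Vᶜ x)) {x : G} (hx : x ∉ V) :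
    ∃ φ, IsEdge V φ ∧ φ '' Ioo 0 1 = connectedComponentIn Vᶜ x := by
  classical
  obtain ⟨h⟩ := hcomp x hx
  set e := connectedComponentIn Vᶜ x with he
  set φ : ℝ → G := fun t => if ht : t ∈ Ioo (0 : ℝ) 1 then h.symm ⟨t, ht⟩ else x with hφ
  set g : G → ℝ := fun y => if hy : y ∈ e then h ⟨y, hy⟩ else 0 with hg
  have hφ_apply : ∀ t (ht : t ∈ Ioo (0 : ℝ) 1), φ t = h.symm ⟨t, ht⟩ := fun t ht => dif_pos ht
  have hg_apply : ∀ y (hy : y ∈ e), g y = h ⟨y, hy⟩ := fun y hy => dif_pos hy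
  have hφc : ContinuousOn φ (Ioo 0 1) := by
    rw [continuousOn_iff_continuous_domRestrict]
    have : (Ioo (0 : ℝ) 1).domRestrict φ = fun t => (h.symm t : G) := by
      ext t; exact hφ_apply t.1 t.2
    rw [this]
    exact continuous_subtype_val.comp h.symm.continuous
  have hgc : ContinuousOn g e := by
    rw [continuousOn_iff_continuous_domRestrict]
    have : e.domRestrict g = fun y => (h y : ℝ) := by
      ext y; exact hg_apply y.1 y.2
    rw [this]
    exact continuous_subtype_val.comp h.continuous
  have hφmem : ∀ t ∈ Ioo (0 : ℝ) 1, φ t ∈ e := fun t ht => by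
    rw [hφ_apply t ht]; exact (h.symm ⟨t, ht⟩).2
  have hgφ : ∀ t ∈ Ioo (0 : ℝ) 1, g (φ t) = t := fun t ht => by
    rw [hg_apply _ (hφmem t ht)]; simp [hφ_apply t ht]
  have himage : φ '' Ioo 0 1 = e := by
    refine Subset.antisymm (image_subset_iff.2 hφmem) fun y hy => ⟨h ⟨y, hy⟩, (h ⟨y, hy⟩).2, ?_⟩
    rw [hφ_apply _ (h ⟨y, hy⟩).2]; simp
  obtain ⟨v, hv, hvt⟩ := exists_tendsto_of_mapClusterPt_finite hφc hV fun y hy =>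
    mapClusterPt_mem_of_component himage (himage ▸ hgc) hgφ hy
  have hrc : ContinuousOn (fun t => φ (1 - t)) (Ioo 0 1) :=
    hφc.comp (continuous_const.sub continuous_id).continuousOn fun t ht => one_sub_mem_Ioo ht
  have hrimage := (image_one_sub_Ioo φ).trans himage
  obtain ⟨w, hw, hwt⟩ := exists_tendsto_of_mapClusterPt_finite hrc hV fun y hy =>
    mapClusterPt_mem_of_component (g := fun y => 1 - g y) hrimage
      (continuousOn_const.sub (hrimage ▸ hgc))
      (fun t ht => by simp [hgφ _ (one_sub_mem_Ioo ht)]) hy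
  have hwt' : Tendsto φ (𝓝[>] 0) (𝓝 w) := by
    simpa [Function.comp_def] using hwt.comp tendsto_one_sub_nhdsGT_zero
  have hext : ∀ t ∈ Ioo (0 : ℝ) 1, extendFrom (Ioo 0 1) φ t = φ t := extendFrom_extends hφc
  have hextimage : extendFrom (Ioo 0 1) φ '' Ioo 0 1 = e := (image_congr hext).trans himage
  refine ⟨extendFrom (Ioo 0 1) φ, ?_, hextimage⟩
  refine ⟨continuousOn_Icc_extendFrom_Ioo hφc hwt' hvt, fun s hs t ht hst => ?_, fun t ht => ?_,
    ?_, ?_, fun t ht => ?_⟩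
  · rw [hext s hs, hext t ht] at hst
    rw [← hgφ s hs, hst, hgφ t ht]
  · rw [hext t ht]
    exact connectedComponentIn_subset _ _ (hφmem t ht)
  · rwa [eq_lim_at_left_extendFrom_Ioo one_pos hwt']
  · rwa [eq_lim_at_right_extendFrom_Ioo one_pos hvt]
  · rw [hextimage, hext t ht]
    exact (connectedComponentIn_eq (hφmem t ht)).symm

namespace IsEdge

variable {V : Set G} {φ ψ : ℝ → G}

theorem reverse [TopologicalSpace G] (h : IsEdge V φ) : IsEdge V fun t => φ (1 - t) where
  continuousOn := h.continuousOn.comp (continuous_const.sub continuous_id).continuousOn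
    fun t ht => ⟨by linarith [ht.2], by linarith [ht.1]⟩
  injOn s hs t ht hst := by
    have := h.injOn (one_sub_mem_Ioo hs) (one_sub_mem_Ioo ht) hst
    linarith
  notMem t ht := h.notMem _ (one_sub_mem_Ioo ht)
  zero_mem := by simpa using h.one_mem
  one_mem := by simpa using h.zero_mem
  component t ht := by
    rw [image_one_sub_Ioo]
    exact h.component _ (one_sub_mem_Ioo ht)

theorem image_eq_of_mem [TopologicalSpace G] (hφ : IsEdge V φ) (hψ : IsEdge V ψ) {x : G}
    (h1 : x ∈ φ '' Ioo 0 1) (h2 : x ∈ ψ '' Ioo 0 1) : φ '' Ioo 0 1 = ψ '' Ioo 0 1 := by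
  obtain ⟨s, hs, rfl⟩ := h1
  obtain ⟨t, ht, hst⟩ := h2
  rw [← hφ.component s hs, ← hψ.component t ht, hst]

variable [TopologicalSpace G] [T2Space G]
theorem zero_ne_one (hcirc : ∀ C : Set G, IsCircle C → 3 ≤ (C ∩ V).ncard)
    (h : IsEdge V φ) : φ 0 ≠ φ 1 := by
  intro h01
  have hi : InjOn φ (Ico 0 1) := by
    intro s hs t ht hst
    rcases hs.1.eq_or_lt with rfl | hs0 <;> rcases ht.1.eq_or_lt with rfl | ht0
    · rfl
    · exact absurd (hst ▸ h.zero_mem) (h.notMem t ⟨ht0, ht.2⟩)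
    · exact absurd (hst ▸ h.zero_mem) (h.notMem s ⟨hs0, hs.2⟩)
    · exact h.injOn ⟨hs0, hs.2⟩ ⟨ht0, ht.2⟩ hst
  have h3 := hcirc _ (isCircle_image h.continuousOn hi h01)
  have hsub : φ '' Icc 0 1 ∩ V ⊆ {φ 0} := by
    rintro _ ⟨⟨t, ht, rfl⟩, htV⟩
    rcases ht.1.eq_or_lt with rfl | ht0
    · rfl
    rcases ht.2.eq_or_lt with rfl | ht1
    · exact h01.symm
    exact absurd htV (h.notMem t ⟨ht0, ht1⟩)
  have := ncard_le_ncard hsub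
  rw [ncard_singleton] at this
  omega

theorem injOn_Icc (hcirc : ∀ C : Set G, IsCircle C → 3 ≤ (C ∩ V).ncard)
    (h : IsEdge V φ) : InjOn φ (Icc 0 1) := by
  have h01 := h.zero_ne_one hcirc
  intro s hs t ht hst
  rcases hs.1.eq_or_lt with rfl | hs0 <;> rcases ht.1.eq_or_lt with rfl | ht0
  · rfl
  · rcases ht.2.eq_or_lt with rfl | ht1
    · exact absurd hst h01
    · exact absurd (hst ▸ h.zero_mem) (h.notMem t ⟨ht0, ht1⟩)
  · rcases hs.2.eq_or_lt with rfl | hs1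
    · exact absurd hst.symm h01
    · exact absurd (hst ▸ h.zero_mem) (h.notMem s ⟨hs0, hs1⟩)
  · rcases hs.2.eq_or_lt with rfl | hs1 <;> rcases ht.2.eq_or_lt with rfl | ht1
    · rfl
    · exact absurd (hst ▸ h.one_mem) (h.notMem t ⟨ht0, ht1⟩)
    · exact absurd (hst ▸ h.one_mem) (h.notMem s ⟨hs0, hs1⟩)
    · exact h.injOn ⟨hs0, hs1⟩ ⟨ht0, ht1⟩ hst

theorem image_eq_of_endpoints (hcirc : ∀ C : Set G, IsCircle C → 3 ≤ (C ∩ V).ncard)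
    (hφ : IsEdge V φ) (hψ : IsEdge V ψ) (h0 : φ 0 = ψ 0) (h1 : φ 1 = ψ 1) :
    φ '' Ioo 0 1 = ψ '' Ioo 0 1 := by
  by_contra hne
  have hdisj : ∀ x ∈ φ '' Ioo 0 1, x ∉ ψ '' Ioo 0 1 := fun x hx hx' =>
    hne (hφ.image_eq_of_mem hψ hx hx')
  set γ : ℝ → G := fun t => if t ≤ 1 / 2 then φ (2 * t) else ψ (2 - 2 * t) with hγ
  have hγ1 : ∀ t ≤ 1 / 2, γ t = φ (2 * t) := fun t ht => if_pos ht
  have hγ2 : ∀ t, 1 / 2 ≤ t → γ t = ψ (2 - 2 * t) := by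
    intro t ht
    rcases ht.eq_or_lt with rfl | ht
    · rw [hγ1 _ le_rfl]; norm_num [h1]
    · exact if_neg (not_le.2 ht)
  have hc : ContinuousOn γ (Icc 0 1) := by
    rw [← Icc_union_Icc_eq_Icc (show (0 : ℝ) ≤ 1 / 2 by norm_num) (by norm_num)]
    refine ContinuousOn.union_of_isClosed ?_ ?_ isClosed_Icc isClosed_Icc
    · refine ContinuousOn.congr (f := fun t => φ (2 * t)) (hφ.continuousOn.comp (by fun_prop)
        fun t ht => ⟨?_, ?_⟩) fun t ht => hγ1 t ht.2
      · linarith [ht.1]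
      · linarith [ht.2]
    · refine ContinuousOn.congr (f := fun t => ψ (2 - 2 * t)) (hψ.continuousOn.comp (by fun_prop)
        fun t ht => ⟨?_, ?_⟩) fun t ht => hγ2 t ht.1
      · linarith [ht.2]
      · linarith [ht.1]
  have hφi := hφ.injOn_Icc hcirc
  have hψi := hψ.injOn_Icc hcirc
  have hcross : ∀ s ∈ Icc (0 : ℝ) 1, ∀ t ∈ Ioo (0 : ℝ) 1, φ s ≠ ψ t := by
    intro s hs t ht hst
    rcases hs.1.eq_or_lt with rfl | hs0
    · exact hψ.notMem t ht (hst ▸ hφ.zero_mem)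
    rcases hs.2.eq_or_lt with rfl | hs1
    · exact hψ.notMem t ht (hst ▸ hφ.one_mem)
    exact hdisj _ ⟨s, ⟨hs0, hs1⟩, rfl⟩ ⟨t, ht, hst.symm⟩
  have hi : InjOn γ (Ico 0 1) := by
    intro s hs t ht hst
    rcases le_or_gt s (1 / 2) with hs2 | hs2 <;> rcases le_or_gt t (1 / 2) with ht2 | ht2
    · rw [hγ1 s hs2, hγ1 t ht2] at hst
      have := hφi ⟨by linarith [hs.1], by linarith⟩ ⟨by linarith [ht.1], by linarith⟩ hst
      linarith
    · rw [hγ1 s hs2, hγ2 t ht2.le] at hst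
      exact absurd hst (hcross _ ⟨by linarith [hs.1], by linarith⟩ _
        ⟨by linarith [ht.2], by linarith⟩)
    · rw [hγ2 s hs2.le, hγ1 t ht2] at hst
      exact absurd hst.symm (hcross _ ⟨by linarith [ht.1], by linarith⟩ _
        ⟨by linarith [hs.2], by linarith⟩)
    · rw [hγ2 s hs2.le, hγ2 t ht2.le] at hst
      have := hψi ⟨by linarith [hs.2], by linarith⟩ ⟨by linarith [ht.2], by linarith⟩ hst
      linarith
  have h01 : γ 0 = γ 1 := by
    rw [hγ1 0 (by norm_num), hγ2 1 (by norm_num)]; norm_num [h0]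
  have h3 := hcirc _ (isCircle_image hc hi h01)
  have hsub : γ '' Icc 0 1 ∩ V ⊆ {φ 0, φ 1} := by
    have hend : ∀ θ, IsEdge V θ → ∀ s ∈ Icc (0 : ℝ) 1, θ s ∈ V → θ s ∈ ({θ 0, θ 1} : Set G) := by
      intro θ hθ s hs hsV
      rcases hs.1.eq_or_lt with rfl | hs0
      · exact Or.inl rfl
      rcases hs.2.eq_or_lt with rfl | hs1
      · exact Or.inr rfl
      exact absurd hsV (hθ.notMem s ⟨hs0, hs1⟩)
    rintro _ ⟨⟨t, ht, rfl⟩, htV⟩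
    rcases le_total t (1 / 2) with ht2 | ht2
    · rw [hγ1 t ht2] at htV ⊢
      exact hend φ hφ _ ⟨by linarith [ht.1], by linarith⟩ htV
    · rw [hγ2 t ht2] at htV ⊢
      rw [h0, h1]
      exact hend ψ hψ _ ⟨by linarith [ht.2], by linarith⟩ htV
  have := ncard_le_ncard hsub
  have := ncard_insert_le (φ 0) {φ 1}
  rw [ncard_singleton] at this
  omega

end IsEdge

/-- A graph has finitely many edges; they can be listed with both orientations. -/
theorem IsTopGraph.exists_finite_edges [MetricSpace G] {V : Set G} (hG : IsTopGraph V) :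
    ∃ Φ : Set (ℝ → G), Φ.Finite ∧ (∀ φ ∈ Φ, IsEdge V φ) ∧ (∀ φ ∈ Φ, (fun t => φ (1 - t)) ∈ Φ) ∧
      ∀ x ∉ V, ∃ φ ∈ Φ, x ∈ φ '' Ioo 0 1 := by
  have := hG.compact
  set 𝓒 : Set (Set G) := (fun x => connectedComponentIn Vᶜ x) '' Vᶜ with h𝓒
  have hex : ∀ c ∈ 𝓒, ∃ φ, IsEdge V φ ∧ φ '' Ioo 0 1 = c := by
    rintro _ ⟨x, hx, rfl⟩
    exact exists_isEdge hG.finite_vertexSet hG.component_openArc hx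
  have : Nonempty G := hG.connected.toNonempty
  choose! e he hec using hex
  have h𝓒fin : 𝓒.Finite := by
    refine Finite.of_finite_image (f := fun c => (e c 0, e c 1))
      ((hG.finite_vertexSet.prod hG.finite_vertexSet).subset ?_) fun c hc d hd hcd => ?_
    · rintro _ ⟨c, hc, rfl⟩
      exact ⟨(he c hc).zero_mem, (he c hc).one_mem⟩
    · rw [← hec c hc, ← hec d hd]
      exact (he c hc).image_eq_of_endpoints hG.circle_vertices (he d hd)
        (congrArg Prod.fst hcd) (congrArg Prod.snd hcd)
  refine ⟨e '' 𝓒 ∪ (fun φ t => φ (1 - t)) '' (e '' 𝓒),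
    (h𝓒fin.image e).union ((h𝓒fin.image e).image _), ?_, ?_, ?_⟩
  · rintro _ (⟨c, hc, rfl⟩ | ⟨_, ⟨c, hc, rfl⟩, rfl⟩)
    · exact he c hc
    · exact (he c hc).reverse
  · rintro _ (h | ⟨φ, h, rfl⟩)
    · exact Or.inr ⟨_, h, rfl⟩
    · simpa using Or.inl h
  · intro x hx
    have hc : connectedComponentIn Vᶜ x ∈ 𝓒 := ⟨x, hx, rfl⟩
    refine ⟨_, Or.inl ⟨_, hc, rfl⟩, ?_⟩
    rw [hec _ hc]
    exact mem_connectedComponentIn hx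

theorem IsTopGraph.isProng_of_isEdge [MetricSpace G] {V : Set G} (hG : IsTopGraph V) {φ : ℝ → G}
    (hφ : IsEdge V φ) : IsProng V φ := by
  have hi := hφ.injOn_Icc hG.circle_vertices
  refine ⟨hφ.continuousOn, hi, fun s t hs ht => ?_, hφ.notMem⟩
  obtain ⟨Φ, hΦ, hΦe, -, hcov⟩ := hG.exists_finite_edges
  have hclosed : ∀ S : Set ℝ, IsClosed S → ∀ ψ, IsEdge V ψ → IsClosed (ψ '' (Icc 0 1 ∩ S)) :=
    fun S hS ψ hψ => ((isCompact_Icc.inter_right hS).image_of_continuousOn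
      (hψ.continuousOn.mono inter_subset_left)).isClosed
  have hcompl : (φ '' Ioo s t)ᶜ = (V ∪ ⋃ ψ ∈ {ψ ∈ Φ | ψ '' Ioo 0 1 ≠ φ '' Ioo 0 1},
      ψ '' (Icc 0 1 ∩ univ)) ∪ φ '' (Icc 0 1 ∩ (Ioo s t)ᶜ) := by
    ext x
    constructor
    · intro hx
      by_cases hxV : x ∈ V
      · exact Or.inl (Or.inl hxV)
      obtain ⟨ψ, hψ, hxψ⟩ := hcov x hxV
      by_cases hne : ψ '' Ioo 0 1 = φ '' Ioo 0 1
      · rw [hne] at hxψ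
        obtain ⟨r, hr, rfl⟩ := hxψ
        exact Or.inr ⟨r, ⟨Ioo_subset_Icc_self hr, fun h => hx ⟨r, h, rfl⟩⟩, rfl⟩
      · refine Or.inl (Or.inr (mem_iUnion₂.2 ⟨ψ, ⟨hψ, hne⟩, ?_⟩))
        rw [inter_univ]
        exact image_mono Ioo_subset_Icc_self hxψ
    · rintro hx ⟨r, hr, rfl⟩
      have hr' : r ∈ Ioo (0 : ℝ) 1 := ⟨hs.trans_lt hr.1, hr.2.trans_le ht⟩
      rcases hx with (hx | hx) | ⟨q, hq, hqr⟩
      · exact hφ.notMem r hr' hx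
      · obtain ⟨ψ, ⟨hψ, hne⟩, q, ⟨hq, -⟩, hqr⟩ := mem_iUnion₂.1 hx
        have hqV : ψ q ∉ V := hqr ▸ hφ.notMem r hr'
        have hq' : q ∈ Ioo (0 : ℝ) 1 := by
          refine ⟨hq.1.lt_of_ne ?_, hq.2.lt_of_ne ?_⟩
          · rintro rfl; exact hqV (hΦe ψ hψ).zero_mem
          · rintro rfl; exact hqV (hΦe ψ hψ).one_mem
        exact hne ((hΦe ψ hψ).image_eq_of_mem hφ ⟨q, hq', hqr⟩ ⟨r, hr', rfl⟩)
      · exact hq.2 (hi hq.1 (Ioo_subset_Icc_self hr') hqr ▸ hr)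
  rw [← isClosed_compl_iff, hcompl]
  refine (hG.finite_vertexSet.isClosed.union ?_).union (hclosed _ isOpen_Ioo.isClosed_compl φ hφ)
  exact (hΦ.subset (sep_subset _ _)).isClosed_biUnion fun ψ hψ =>
    hclosed _ isClosed_univ ψ (hΦe ψ hψ.1)

/-- In a graph, every arc with no interior vertices is a prong. -/
theorem IsTopGraph.isProng [MetricSpace G] {V : Set G} (hG : IsTopGraph V) {γ : ℝ → G}
    (hc : ContinuousOn γ (Icc 0 1)) (hi : InjOn γ (Icc 0 1)) (hV : ∀ t ∈ Ioo (0 : ℝ) 1, γ t ∉ V) :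
    IsProng V γ := by
  refine ⟨hc, hi, fun s t hs ht => ?_, hV⟩
  obtain ⟨Φ, -, hΦe, -, hcov⟩ := hG.exists_finite_edges
  have hsub : Ioo s t ⊆ Ioo 0 1 := Ioo_subset_Ioo hs ht
  have hhalf : (1 / 2 : ℝ) ∈ Ioo (0 : ℝ) 1 := by norm_num
  obtain ⟨φ, hφ, q, hq, hqγ⟩ := hcov (γ (1 / 2)) (hV _ hhalf)
  have hφe := hΦe φ hφ
  have hφp := hG.isProng_of_isEdge hφe
  have himage : γ '' Ioo 0 1 ⊆ φ '' Ioo 0 1 := by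
    rw [← hφe.component q hq, hqγ]
    refine (isPreconnected_Ioo.image _ (hc.mono Ioo_subset_Icc_self)).subset_connectedComponentIn
      ⟨_, hhalf, rfl⟩ ?_
    rintro _ ⟨r, hr, rfl⟩
    exact hV r hr
  set g : ℝ → ℝ := fun r => IsProng.param φ (γ r) with hg
  have hφg : ∀ r ∈ Ioo (0 : ℝ) 1, g r ∈ Ioo (0 : ℝ) 1 ∧ φ (g r) = γ r := by
    intro r hr
    obtain ⟨p, hp, hpr⟩ := himage ⟨r, hr, rfl⟩
    have : g r = p := by rw [hg]; simp only [← hpr, hφp.param_apply hp]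
    rw [this]
    exact ⟨hp, hpr⟩
  have hgc : ContinuousOn g (Ioo 0 1) := hφp.continuousOn_param.comp
    (hc.mono Ioo_subset_Icc_self) fun r hr => himage ⟨r, hr, rfl⟩
  have hgi : InjOn g (Ioo 0 1) := fun r hr q hq hrq =>
    hi (Ioo_subset_Icc_self hr) (Ioo_subset_Icc_self hq)
      (by rw [← (hφg r hr).2, hrq, (hφg q hq).2])
  rw [isOpen_iff_mem_nhds]
  rintro _ ⟨r, hr, rfl⟩
  obtain ⟨a, ha⟩ := exists_between hr.1
  obtain ⟨b, hb⟩ := exists_between hr.2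
  have hab : Icc a b ⊆ Ioo s t := fun q hq => ⟨ha.1.trans_le hq.1, hq.2.trans_lt hb.2⟩
  have hle : a ≤ b := (ha.2.trans hb.1).le
  have hal : a ∈ Icc a b := left_mem_Icc.2 hle
  have hbr : b ∈ Icc a b := right_mem_Icc.2 hle
  have hrm : r ∈ Icc a b := ⟨ha.2.le, hb.1.le⟩
  have hgab := hgc.mono (hab.trans hsub)
  have hivt : uIcc (g a) (g b) ⊆ g '' Icc a b := by
    rw [← uIcc_of_le hle] at hgab ⊢
    exact intermediate_value_uIcc hgab
  have key : ∀ c d, Ioo c d ⊆ uIcc (g a) (g b) → 0 ≤ c → d ≤ 1 → g r ∈ Ioo c d →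
      γ '' Ioo s t ∈ 𝓝 (γ r) := by
    intro c d hcd hc0 hd1 hgr
    refine mem_of_superset ((hφp.isOpen_image c d hc0 hd1).mem_nhds
      ⟨g r, hgr, (hφg r (hsub hr)).2⟩) ?_
    rintro _ ⟨p, hp, rfl⟩
    obtain ⟨q, hq, rfl⟩ := hivt (hcd hp)
    exact ⟨q, hab hq, ((hφg q (hsub (hab hq))).2).symm⟩
  have hga := (hφg a (hsub (hab hal))).1
  have hgb := (hφg b (hsub (hab hbr))).1
  rcases hgab.strictMonoOn_of_injOn_Icc' hle (hgi.mono (hab.trans hsub)) with hm | hm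
  · exact key (g a) (g b) (Ioo_subset_Icc_self.trans Icc_subset_uIcc) hga.1.le hgb.2.le
      ⟨hm hal hrm ha.2, hm hrm hbr hb.1⟩
  · exact key (g b) (g a) (Ioo_subset_Icc_self.trans Icc_subset_uIcc') hgb.1.le hga.2.le
      ⟨hm hrm hbr hb.1, hm hal hrm ha.2⟩

theorem IsTopGraph.isProng_comp [MetricSpace G] {V : Set G} (hG : IsTopGraph V) {φ : ℝ → G}
    (hφ : IsProng V φ) {α β : ℝ} (hβ : β ≠ 0) (h0 : α ∈ Icc (0 : ℝ) 1)
    (h1 : α + β ∈ Icc (0 : ℝ) 1) : IsProng V fun t => φ (α + β * t) := by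
  have hmaps : ∀ t ∈ Icc (0 : ℝ) 1, α + β * t ∈ Icc (0 : ℝ) 1 := by
    intro t ht
    constructor <;> nlinarith [ht.1, ht.2, h0.1, h0.2, h1.1, h1.2]
  refine hG.isProng (hφ.continuousOn.comp (by fun_prop) hmaps) (fun s hs t ht hst => ?_)
    fun t ht => hφ.notMem _ ?_
  · have := hφ.injOn (hmaps s hs) (hmaps t ht) hst
    exact mul_left_cancel₀ hβ (add_left_cancel this)
  · rcases hβ.lt_or_gt with hβ | hβ <;> constructor <;>
      nlinarith [ht.1, ht.2, h0.1, h0.2, h1.1, h1.2]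

/-- Every point of a graph has a star. -/
theorem IsTopGraph.exists_isStar [MetricSpace G] {V : Set G} (hG : IsTopGraph V) (p : G) :
    ∃ E, IsStar V p E := by
  obtain ⟨Φ, hΦ, hΦe, hΦr, hcov⟩ := hG.exists_finite_edges
  by_cases hp : p ∈ V
  · refine ⟨(fun φ t => φ (1 / 2 + 1 / 2 * t)) '' {φ ∈ Φ | φ 1 = p},
      (hΦ.subset (sep_subset _ _)).image _, ?_, ?_, fun a ha0 ha1 => ?_⟩
    · rintro _ ⟨φ, ⟨hφ, -⟩, rfl⟩
      exact hG.isProng_comp (hG.isProng_of_isEdge (hΦe φ hφ)) (by norm_num) (by norm_num)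
        (by norm_num)
    · rintro _ ⟨φ, ⟨-, hφp⟩, rfl⟩
      norm_num [hφp]
    · set c := (1 + a) / 2 with hc
      have hc1 : c < 1 := by linarith
      set S : (ℝ → G) → Set ℝ := fun φ =>
        {t | t ∈ Icc (0 : ℝ) 1 ∧ (φ 0 = p → 1 - c ≤ t) ∧ (φ 1 = p → t ≤ c)} with hS
      have hSc : ∀ φ, IsCompact (S φ) := by
        intro φ
        refine isCompact_Icc.inter_right (IsClosed.inter ?_ ?_)
        · by_cases h : φ 0 = p <;> simp only [h, true_imp_iff, false_imp_iff]
          exacts [isClosed_Ici, isClosed_univ]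
        · by_cases h : φ 1 = p <;> simp only [h, true_imp_iff, false_imp_iff]
          exacts [isClosed_Iic, isClosed_univ]
      set C : Set G := (V \ {p}) ∪ ⋃ φ ∈ Φ, φ '' S φ with hC
      have hCc : IsClosed C := by
        refine (hG.finite_vertexSet.subset sdiff_subset).isClosed.union
          (hΦ.isClosed_biUnion fun φ hφ => ?_)
        exact ((hSc φ).image_of_continuousOn
          ((hΦe φ hφ).continuousOn.mono fun t ht => ht.1)).isClosed
      have hpC : p ∉ C := by
        rintro (h | h)
        · exact h.2 rfl
        · obtain ⟨φ, hφ, t, ⟨ht, h0, h1⟩, rfl⟩ := mem_iUnion₂.1 h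
          rcases ht.1.eq_or_lt with rfl | ht0
          · linarith [h0 rfl]
          rcases ht.2.eq_or_lt with rfl | ht1
          · linarith [h1 rfl]
          exact (hΦe φ hφ).notMem t ⟨ht0, ht1⟩ hp
      refine mem_of_superset (hCc.isOpen_compl.mem_nhds hpC) fun x hx => ?_
      by_cases hxV : x ∈ V
      · left
        by_contra hne
        exact hx (Or.inl ⟨hxV, hne⟩)
      right
      have hfound : ∀ φ ∈ Φ, φ 1 = p → ∀ t, c < t → t < 1 → x = φ t →
          x ∈ ⋃ γ ∈ (fun φ t => φ (1 / 2 + 1 / 2 * t)) '' {φ ∈ Φ | φ 1 = p}, γ '' Ioo a 1 := by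
        intro φ hφ hφp t hct ht1 hxt
        refine mem_iUnion₂.2 ⟨_, ⟨φ, ⟨hφ, hφp⟩, rfl⟩, 2 * t - 1, ⟨by linarith, by linarith⟩, ?_⟩
        rw [hxt]
        ring_nf
      obtain ⟨φ, hφ, t, ht, rfl⟩ := hcov x hxV
      have hnS : t ∉ S φ := fun h => hx (Or.inr (mem_iUnion₂.2 ⟨φ, hφ, t, h, rfl⟩))
      by_cases h0 : φ 0 = p ∧ t < 1 - c
      · exact hfound _ (hΦr φ hφ) (by simpa using h0.1) (1 - t) (by linarith [h0.2])
          (by linarith [ht.1]) (by simp)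
      by_cases h1 : φ 1 = p ∧ c < t
      · exact hfound φ hφ h1.1 t h1.2 ht.2 rfl
      · refine absurd ⟨Ioo_subset_Icc_self ht, fun h => ?_, fun h => ?_⟩ hnS
        · by_contra hlt
          exact h0 ⟨h, not_le.1 hlt⟩
        · by_contra hlt
          exact h1 ⟨h, not_le.1 hlt⟩
  · obtain ⟨φ, hφ, t₀, ht₀, rfl⟩ := hcov p hp
    have hφp := hG.isProng_of_isEdge (hΦe φ hφ)
    refine ⟨{fun t => φ (0 + t₀ * t), fun t => φ (1 + (t₀ - 1) * t)}, by simp, ?_, ?_,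
      fun a ha0 ha1 => ?_⟩
    · rintro _ (rfl | rfl)
      · exact hG.isProng_comp hφp ht₀.1.ne' (by simp) (by simpa using Ioo_subset_Icc_self ht₀)
      · exact hG.isProng_comp hφp (by linarith [ht₀.2]) (by simp)
          (by simpa using Ioo_subset_Icc_self ht₀)
    · rintro _ (rfl | rfl) <;> simp
    · have h1 : t₀ * a < t₀ := by nlinarith [ht₀.1]
      have h2 : t₀ < 1 + (t₀ - 1) * a := by nlinarith [ht₀.2]
      refine mem_of_superset ((hφp.isOpen_image (t₀ * a) (1 + (t₀ - 1) * a)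
        (mul_nonneg ht₀.1.le ha0) (by nlinarith [ht₀.2])).mem_nhds ⟨t₀, ⟨h1, h2⟩, rfl⟩) ?_
      rintro _ ⟨t, ht, rfl⟩
      rcases lt_trichotomy t t₀ with h | rfl | h
      · refine Or.inr (mem_iUnion₂.2 ⟨_, Or.inl rfl, t / t₀, ⟨?_, ?_⟩, ?_⟩)
        · rw [lt_div_iff₀ ht₀.1]; linarith [ht.1]
        · rwa [div_lt_one ht₀.1]
        · simp only [zero_add, mul_div_cancel₀ t ht₀.1.ne']
      · exact Or.inl rfl
      · have hpos : 0 < 1 - t₀ := by linarith [ht₀.2]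
        refine Or.inr (mem_iUnion₂.2 ⟨_, Or.inr rfl, (1 - t) / (1 - t₀), ⟨?_, ?_⟩, ?_⟩)
        · rw [lt_div_iff₀ hpos]; linarith [ht.2]
        · rw [div_lt_one hpos]; linarith
        · have : 1 + (t₀ - 1) * ((1 - t) / (1 - t₀)) = t := by
            field_simp
            ring
          simp only [this]

end Edges

section AttractingProng

/-- A prong in `X` whose tip is the only point approached but not attained by `X`, whose points
are pushed towards the tip, and which is eventually visited by all points of `X`. -/
structure IsAttractingProng [TopologicalSpace G] (V : Set G) (f : G → G) (X : Set G)
    (γ : ℝ → G) : Prop where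
  isProng : IsProng V γ
  apply_mem : ∀ t ∈ Ioo (0 : ℝ) 1, γ t ∈ X
  closure_diff : closure X \ X = {γ 1}
  fixed : f (γ 1) = γ 1
  forall_lt : ∀ t ∈ Ico (0 : ℝ) 1, ∃ s ∈ Ioo t 1, f (γ t) = γ s
  subset_invOrbit : X ⊆ invOrbit f (γ '' Ioo 0 1)

variable {V : Set G} {f : G → G} {X : Set G} {γ : ℝ → G}

theorem subset_mainAbsorbed [TopologicalSpace G] {K : Set G} (hX : IsPreconnected X)
    (h : X ⊆ invOrbit f K) (hne : (X ∩ K).Nonempty) : X ⊆ mainAbsorbed f K := by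
  obtain ⟨x, hx, hxK⟩ := hne
  exact fun y hy => mem_iUnion₂.2 ⟨x, hxK, hX.subset_connectedComponentIn hx h hy⟩

theorem mainAbsorbed_subset_invOrbit [TopologicalSpace G] {K : Set G} :
    mainAbsorbed f K ⊆ invOrbit f K :=
  iUnion₂_subset fun _ _ => connectedComponentIn_subset _ _

theorem image_unitInterval (γ : ℝ → G) (δ : unitInterval → G) (h : ∀ t : unitInterval, δ t = γ t) :
    δ '' {t : unitInterval | 0 < t ∧ t < 1} = γ '' Ioo 0 1 := by
  ext x
  constructor
  · rintro ⟨t, ⟨h0, h1⟩, rfl⟩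
    exact ⟨t, ⟨h0, h1⟩, (h t).symm⟩
  · rintro ⟨t, ht, rfl⟩
    exact ⟨⟨t, Ioo_subset_Icc_self ht⟩, ⟨ht.1, ht.2⟩, h _⟩

theorem IsAttractingProng.exists_arc [TopologicalSpace G] (h : IsAttractingProng V f X γ)
    (hX : IsPreconnected X) :
    ∃ γ : unitInterval → G, Continuous γ ∧ Function.Injective γ ∧
      γ '' {t : unitInterval | 0 < t ∧ t < 1} ⊆ X \ V ∧
      closure X \ X = {γ 1} ∧ f (γ 1) = γ 1 ∧
      (∀ t : unitInterval, t < 1 → ∃ s : unitInterval, t < s ∧ s < 1 ∧ f (γ t) = γ s) ∧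
      X ⊆ mainAbsorbed f (γ '' {t : unitInterval | 0 < t ∧ t < 1}) := by
  have himage := image_unitInterval γ (fun t => γ t) fun _ => rfl
  refine ⟨fun t => γ t, h.isProng.continuousOn.comp_continuous continuous_subtype_val fun t => t.2,
    fun s t hst => Subtype.ext (h.isProng.injOn s.2 t.2 hst), ?_, h.closure_diff, h.fixed,
    fun t ht => ?_, ?_⟩
  · rw [himage]
    rintro _ ⟨t, ht, rfl⟩
    exact ⟨h.apply_mem t ht, h.isProng.notMem t ht⟩
  · obtain ⟨s, hs, hts⟩ := h.forall_lt t ⟨t.2.1, ht⟩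
    exact ⟨⟨s, t.2.1.trans hs.1.le, hs.2.le⟩, hs.1, hs.2, hts⟩
  · rw [himage]
    have hhalf : (1 / 2 : ℝ) ∈ Ioo (0 : ℝ) 1 := by norm_num
    exact subset_mainAbsorbed hX h.subset_invOrbit ⟨_, h.apply_mem _ hhalf, _, hhalf, rfl⟩

theorem IsTopGraph.isAttractingProng_of_arc [MetricSpace G] (hG : IsTopGraph V)
    {δ : unitInterval → G} (hc : Continuous δ) (hi : Injective δ)
    (hsub : δ '' {t : unitInterval | 0 < t ∧ t < 1} ⊆ X \ V) (hdiff : closure X \ X = {δ 1})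
    (hfix : f (δ 1) = δ 1)
    (hlt : ∀ t : unitInterval, t < 1 → ∃ s : unitInterval, t < s ∧ s < 1 ∧ f (δ t) = δ s)
    (hX : X ⊆ mainAbsorbed f (δ '' {t : unitInterval | 0 < t ∧ t < 1})) :
    IsAttractingProng V f X fun t => δ (projIcc 0 1 zero_le_one t) := by
  set γ : ℝ → G := fun t => δ (projIcc 0 1 zero_le_one t) with hγ
  have hγδ : ∀ t : unitInterval, δ t = γ t := fun t => by rw [hγ]; simp only [projIcc_val]
  have hγδ' : ∀ t (ht : t ∈ Icc (0 : ℝ) 1), γ t = δ ⟨t, ht⟩ := fun t ht => (hγδ ⟨t, ht⟩).symm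
  rw [image_unitInterval γ δ hγδ] at hsub hX
  have h1 : γ 1 = δ 1 := (hγδ 1).symm
  refine ⟨hG.isProng (hc.comp continuous_projIcc).continuousOn ?_
    fun t ht => (hsub ⟨t, ht, rfl⟩).2, fun t ht => (hsub ⟨t, ht, rfl⟩).1, h1 ▸ hdiff,
    by rw [h1, hfix], fun t ht => ?_, hX.trans mainAbsorbed_subset_invOrbit⟩
  · intro s hs t ht hst
    rw [hγδ' s hs, hγδ' t ht] at hst
    exact congrArg Subtype.val (hi hst)
  · obtain ⟨s, hs1, hs2, hs⟩ := hlt ⟨t, ht.1, ht.2.le⟩ ht.2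
    exact ⟨s, ⟨hs1, hs2⟩, by rw [hγδ' t ⟨ht.1, ht.2.le⟩, hs, hγδ]⟩

namespace IsAttractingProng

/-- Points of `X` are attracted to the tip, uniformly on a neighbourhood. -/
theorem exists_isOpen_forall_iterate_mem [TopologicalSpace G] (h : IsAttractingProng V f X γ)
    (hf : Continuous f) {x : G} (hx : x ∈ X) {c : ℝ} (hc : c < 1) :
    ∃ U, IsOpen U ∧ x ∈ U ∧ ∃ M, ∀ m ≥ M, ∀ y ∈ U, f^[m] y ∈ γ '' Ioo c 1 := by
  obtain ⟨k, t, ht, hk⟩ := mem_iUnion.1 (h.subset_invOrbit hx)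
  obtain ⟨b, hb0, hbt⟩ := exists_between ht.1
  obtain ⟨J, hJ⟩ := h.isProng.exists_iterate_mem hf le_rfl
    (fun t ht => h.forall_lt t ⟨ht.1.le, ht.2⟩) ⟨hb0, hbt.trans ht.2⟩ hc
  refine ⟨f^[k] ⁻¹' (γ '' Ioo b 1), (h.isProng.isOpen_image b 1 hb0.le le_rfl).preimage
    (hf.iterate k), ⟨t, ⟨hbt, ht.2⟩, hk⟩, J + k, ?_⟩
  rintro m hm y ⟨s, hs, hsy⟩
  have := hJ (m - k) (by omega) s ⟨hs.1.le, hs.2⟩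
  rwa [hsy, ← iterate_add_apply, Nat.sub_add_cancel (by omega)] at this

theorem tendsto_iterate [MetricSpace G] (h : IsAttractingProng V f X γ)
    (hf : Continuous f) {x : G} (hx : x ∈ X) : Tendsto (fun n => f^[n] x) atTop (𝓝 (γ 1)) := by
  refine h.isProng.tendsto_of_eventually_mem fun c hc => ?_
  obtain ⟨U, -, hxU, M, hM⟩ := h.exists_isOpen_forall_iterate_mem hf hx hc
  exact eventually_atTop.2 ⟨M, fun m hm => hM m hm x hxU⟩

theorem tip_notMem [TopologicalSpace G] (h : IsAttractingProng V f X γ) : γ 1 ∉ X :=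
  (h.closure_diff.symm ▸ mem_singleton _ : γ 1 ∈ closure X \ X).2

theorem ne_of_mem [TopologicalSpace G] (h : IsAttractingProng V f X γ) {x : G} (hx : x ∈ X) :
    x ≠ γ 1 := fun he => h.tip_notMem (he ▸ hx)

theorem iterate_ne [MetricSpace G] (h : IsAttractingProng V f X γ) (hf : Continuous f)
    {x : G} (hx : x ∈ X) {m : ℕ} (hm : 0 < m) : f^[m] x ≠ x := by
  intro hp
  refine h.ne_of_mem hx (tendsto_nhds_unique (f := fun n => f^[m * n] x) (l := atTop) ?_
    ((h.tendsto_iterate hf hx).comp (tendsto_id.const_mul_atTop' hm)))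
  refine tendsto_const_nhds.congr fun n => ?_
  rw [iterate_mul]
  exact (iterate_fixed hp n).symm

theorem notMem_nonwanderingPts [MetricSpace G] (h : IsAttractingProng V f X γ)
    (hf : Continuous f) {x : G} (hx : x ∈ X) : x ∉ nonwanderingPts f := by
  intro hnw
  obtain ⟨W, W', hW, hW', hxW, h1W', hd⟩ := t2_separation (h.ne_of_mem hx)
  obtain ⟨c, -, hc, hcW'⟩ := exists_Ioo_of_eventually_nhdsLT
    (h.isProng.tendsto (hW'.mem_nhds h1W'))
  obtain ⟨U, hU, hxU, M, hM⟩ := h.exists_isOpen_forall_iterate_mem hf hx hc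
  have hsmall : ∀ᶠ O in (𝓝 x).smallSets, ∀ m ∈ Ioo 0 M, Disjoint (f^[m] '' O) O := by
    refine (eventually_all_finite (finite_Ioo 0 M)).2 fun m hm => ?_
    obtain ⟨A, B, hA, hB, hxA, hxB, hAB⟩ := t2_separation (h.iterate_ne hf hx hm.1)
    refine eventually_smallSets.2 ⟨f^[m] ⁻¹' A ∩ B, inter_mem
      ((hA.preimage (hf.iterate m)).mem_nhds hxA) (hB.mem_nhds hxB), fun O hO => ?_⟩
    exact hAB.mono (image_subset_iff.2 (hO.trans inter_subset_left)) (hO.trans inter_subset_right)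
  obtain ⟨S, hS, hSd⟩ := eventually_smallSets.1 hsmall
  obtain ⟨O, hOS, hO, hxO⟩ := _root_.mem_nhds_iff.1 hS
  obtain ⟨n, hn, z, ⟨y, hy, rfl⟩, hz⟩ := hnw (O ∩ U ∩ W) ((hO.inter hU).inter hW) ⟨⟨hxO, hxU⟩, hxW⟩
  rcases lt_or_ge n M with hnM | hnM
  · exact disjoint_left.1 (hSd O hOS n ⟨hn, hnM⟩) ⟨y, hy.1.1, rfl⟩ hz.1.1
  · obtain ⟨t, ht, hty⟩ := hM n hnM y hy.1.2
    exact disjoint_left.1 hd hz.2 (hty ▸ hcW' t ht)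

end IsAttractingProng

theorem omegaSet_subset_nonwanderingPts [TopologicalSpace G] (x : G) :
    omegaSet f x ⊆ nonwanderingPts f := by
  intro y hy U hU hyU
  obtain ⟨_, hz, n, rfl⟩ := mem_closure_iff.1 (mem_iInter.1 hy 0) U hU hyU
  obtain ⟨_, hz', m, rfl⟩ := mem_closure_iff.1 (mem_iInter.1 hy (n + 1)) U hU hyU
  refine ⟨m + 1, m.succ_pos, _, ⟨_, hz, ?_⟩, hz'⟩
  rw [← iterate_add_apply]
  congr 1
  omega

theorem omegaLimitSet_subset_nonwanderingPts [TopologicalSpace G] :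
    omegaLimitSet f ⊆ nonwanderingPts f :=
  iUnion_subset omegaSet_subset_nonwanderingPts

theorem recurrentPts_subset_omegaLimitSet [TopologicalSpace G] :
    recurrentPts f ⊆ omegaLimitSet f :=
  fun x hx => mem_iUnion.2 ⟨x, hx⟩

theorem periodicPts_subset_recurrentPts [TopologicalSpace G] :
    periodicPts f ⊆ recurrentPts f := by
  rintro x ⟨m, hm, hx⟩
  refine mem_iInter.2 fun i => subset_closure ⟨m * i - i, ?_⟩
  have : m * i - i + i = m * i := Nat.sub_add_cancel (Nat.le_mul_of_pos_left i hm)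
  simp only [this]
  exact hx.mul_const i

theorem mem_evPeriodicPts_of_iterate_mem_periodicPts {x : G} {i : ℕ}
    (h : f^[i] x ∈ periodicPts f) : x ∈ evPeriodicPts f := by
  obtain ⟨m, hm, hp⟩ := h
  refine ((finite_Iio (m + i)).image fun n => f^[n] x).subset ?_
  rintro _ ⟨n, rfl⟩
  rcases lt_or_ge n i with hn | hn
  · exact ⟨n, by rw [mem_Iio]; omega, rfl⟩
  · refine ⟨(n - i) % m + i, ?_, ?_⟩
    · have := Nat.mod_lt (n - i) hm
      rw [mem_Iio]; omega
    · simp only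
      rw [iterate_add_apply, hp.iterate_mod_apply, ← iterate_add_apply, Nat.sub_add_cancel hn]

/-- If the orbit of `K` never stabilises and contains no periodic point, then it is attracted to
a fixed point along a prong. -/
theorem IsTopGraph.exists_isAttractingProng [MetricSpace G] (hG : IsTopGraph V) {K : Set G}
    (hf : Continuous f) (hK : IsPreconnected K) (hKc : IsClosed K)
    (hmeet : (f '' K ∩ K).Nonempty)
    (hgrow : ∀ n, (setOrbit f K \ setOrbitSeg f K n).Nonempty)
    (hper : ∀ x ∈ setOrbit f K, x ∉ periodicPts f) :
    ∃ γ, IsAttractingProng V f (setOrbit f K) γ := by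
  have := hG.compact
  have hstar := hG.exists_isStar
  have hX := isPreconnected_setOrbit hf hK hmeet
  have hfX : MapsTo f (setOrbit f K) (setOrbit f K) := mapsTo_setOrbit
  have hne : (setOrbit f K).Nonempty := (hgrow 0).mono sdiff_subset
  have key : ∀ v ∈ closure (setOrbit f K) \ setOrbit f K, ∃ γ, IsProng V γ ∧ γ 1 = v ∧
      f (γ 1) = γ 1 ∧ (∃ b, 0 ≤ b ∧ b < 1 ∧ (∀ t ∈ Ioo b 1, γ t ∈ setOrbit f K) ∧
        ∀ t ∈ Ioo b 1, ∃ s ∈ Ioo t 1, f (γ t) = γ s) ∧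
      ∀ c < (1 : ℝ), ∀ y ∈ setOrbit f K, ∀ᶠ n in atTop, f^[n] y ∈ γ '' Ioo c 1 := by
    intro v hv
    obtain ⟨γ, hγ, hγ1, ⟨k, hk⟩, m, hm, a, ha0, ha1, hγX, hmap⟩ :=
      exists_prong_returning hstar hf hK hKc hmeet hgrow hper hv
    have hatt : ∀ c < (1 : ℝ), ∀ y ∈ setOrbit f K, ∀ᶠ n in atTop, f^[n] y ∈ γ '' Ioo c 1 :=
      fun c hc => IsStar.eventually_iterate_mem hstar hf hX hfX hper hγ ha0 ha1 hγX hm hmap hc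
    obtain ⟨hfix, b, hab, hb1, hb⟩ :=
      hγ.fixed_and_forall_lt hf hfX hper hne hγ1 ha0 ha1 hγX hatt
    refine ⟨γ, hγ, ?_, hfix, ⟨b, ha0.trans hab, hb1,
      fun t ht => hγX t ⟨hab.trans_lt ht.1, ht.2⟩, hb⟩, hatt⟩
    rw [← hk, iterate_fixed hfix]
  obtain ⟨-, ⟨v, hv⟩, -⟩ := iInter_closure_diff_setOrbitSeg hstar hf hK hKc hmeet hgrow hper
  obtain ⟨γ, hγ, hγv, hfix, ⟨b, hb0, hb1, hbX, hb⟩, hatt⟩ := key v hv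
  obtain ⟨y, hy⟩ := hne
  have hdiff : closure (setOrbit f K) \ setOrbit f K = {γ 1} := by
    rw [hγv]
    refine Subset.antisymm (fun w hw => ?_) (singleton_subset_iff.2 hv)
    obtain ⟨δ, hδ, hδw, -, -, hδatt⟩ := key w hw
    rw [mem_singleton_iff, ← hδw, ← hγv]
    exact tendsto_nhds_unique (hδ.tendsto_of_eventually_mem fun c hc => hδatt c hc y hy)
      (hγ.tendsto_of_eventually_mem fun c hc => hatt c hc y hy)
  obtain ⟨c, hbc, hc1⟩ := exists_between hb1
  have hc0 : 0 < 1 - c := by linarith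
  have hpar : ∀ t ∈ Ico (0 : ℝ) 1, c + (1 - c) * t ∈ Ioo b 1 := fun t ht =>
    ⟨by nlinarith [ht.1], by nlinarith [ht.2]⟩
  have hpar' : ∀ s, c + (1 - c) * ((s - c) / (1 - c)) = s := fun s => by
    rw [mul_div_cancel₀ _ hc0.ne']; ring
  refine ⟨fun t => γ (c + (1 - c) * t), hG.isProng_comp hγ hc0.ne' ⟨by linarith, hc1.le⟩ (by simp),
    fun t ht => hbX _ (hpar t (Ioo_subset_Ico_self ht)), by simpa using hdiff, by simpa using hfix,
    fun t ht => ?_, fun y hy => ?_⟩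
  · obtain ⟨s, hs, hts⟩ := hb _ (hpar t ht)
    refine ⟨(s - c) / (1 - c), ⟨?_, ?_⟩, ?_⟩
    · rw [lt_div_iff₀ hc0]; linarith [hs.1]
    · rw [div_lt_one hc0]; linarith [hs.2]
    · simp only [hpar', hts]
  · obtain ⟨n, s, hs, hsn⟩ := (hatt c hc1 y hy).exists
    refine mem_iUnion.2 ⟨n, (s - c) / (1 - c), ⟨div_pos (by linarith [hs.1]) hc0, ?_⟩, ?_⟩
    · rw [div_lt_one hc0]; linarith [hs.2]
    · simp only [hpar', hsn]

theorem notMem_periodicPts_of_tendsto_infDist [PseudoMetricSpace G] {S : Set G} (hS : IsClosed S)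
    (hne : S.Nonempty) {x : G} (hx : x ∉ S)
    (h : Tendsto (fun n : ℕ => infDist (f^[n] x) S) atTop (𝓝 0)) : x ∉ periodicPts f := by
  rintro ⟨m, hm, hp⟩
  have h1 := h.comp (tendsto_id.const_mul_atTop' hm)
  have h2 : infDist x S = 0 := by
    refine tendsto_nhds_unique (tendsto_const_nhds.congr fun n => ?_) h1
    simp only [comp_apply, id]
    rw [(hp.mul_const n).eq]
  exact hx ((hS.mem_iff_infDist_zero hne).2 h2)

end AttractingProng

end GraphDynamics

/-- the eight equivalent conditions of Lemma 2.8 for the orbit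
`X = O(K,f)` of a connected closed set `K` with `f(K) ∩ K ≠ ∅` whose orbit never
stabilizes. -/
theorem orbit_tfae {G : Type*} [MetricSpace G] (V : Set G)
    (hG : IsTopGraph V) (f : G → G) (hf : Continuous f) (K : Set G)
    (hKconn : IsConnected K) (hKclosed : IsClosed K)
    (hmeet : (f '' K ∩ K).Nonempty)
    (X : Set G) (hX : X = setOrbit f K)
    (hgrow : ∀ n : ℕ, 1 ≤ n → (X \ setOrbitSeg f K n).Nonempty) :
    List.TFAE
      [K ∩ evPeriodicPts f = ∅,
       X ∩ evPeriodicPts f = ∅,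
       X ∩ Function.periodicPts f = ∅,
       X ∩ recurrentPts f = ∅,
       X ∩ omegaLimitSet f = ∅,
       X ∩ nonwanderingPts f = ∅,
       (closure X \ X).Nonempty ∧ ∀ x ∈ X,
         Filter.Tendsto (fun n : ℕ => Metric.infDist (f^[n] x) (closure X \ X))
           Filter.atTop (nhds 0),
       ∃ γ : unitInterval → G, Continuous γ ∧ Function.Injective γ ∧
         γ '' {t : unitInterval | 0 < t ∧ t < 1} ⊆ X \ V ∧
         closure X \ X = {γ 1} ∧ f (γ 1) = γ 1 ∧
         (∀ t : unitInterval, t < 1 → ∃ s : unitInterval, t < s ∧ s < 1 ∧ f (γ t) = γ s) ∧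
         X ⊆ mainAbsorbed f (γ '' {t : unitInterval | 0 < t ∧ t < 1})] := by
  have hcompact := hG.compact
  subst hX
  have hgrow' : ∀ n, (setOrbit f K \ setOrbitSeg f K n).Nonempty := fun n =>
    (hgrow (n + 1) (by omega)).mono (sdiff_subset_sdiff_right (setOrbitSeg_mono n.le_succ))
  have hXconn := isPreconnected_setOrbit hf hKconn.isPreconnected hmeet
  have hdisj : ∀ {A B C : Set G}, B ⊆ C → A ∩ C = ∅ → A ∩ B = ∅ := fun h hC =>
    subset_empty_iff.1 ((inter_subset_inter_right _ h).trans_eq hC)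
  tfae_have 1 → 3 := by
    intro h
    refine disjoint_iff_inter_eq_empty.1 (disjoint_left.2 fun x hx hper => ?_)
    obtain ⟨i, k, hk, rfl⟩ := mem_setOrbit.1 hx
    exact disjoint_left.1 (disjoint_iff_inter_eq_empty.2 h) hk
      (mem_evPeriodicPts_of_iterate_mem_periodicPts hper)
  tfae_have 3 → 2 := by
    intro h
    refine disjoint_iff_inter_eq_empty.1 (disjoint_left.2 fun x hx hev => ?_)
    obtain ⟨n, hn⟩ := exists_periodicPts_of_finite_orbit hev
    exact disjoint_left.1 (disjoint_iff_inter_eq_empty.2 h) (mapsTo_setOrbit.iterate n hx) hn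
  tfae_have 2 → 1 := fun h =>
    subset_empty_iff.1 ((inter_subset_inter_left _ subset_setOrbit).trans_eq h)
  tfae_have 3 → 8 := by
    intro h
    obtain ⟨γ, hγ⟩ := hG.exists_isAttractingProng hf hKconn.isPreconnected hKclosed hmeet hgrow'
      fun x hx => disjoint_left.1 (disjoint_iff_inter_eq_empty.2 h) hx
    exact hγ.exists_arc hXconn
  tfae_have 8 → 6 := by
    rintro ⟨δ, hc, hi, hsub, hdiff, hfix, hlt, hab⟩
    have hγ := hG.isAttractingProng_of_arc hc hi hsub hdiff hfix hlt hab
    exact disjoint_iff_inter_eq_empty.1 (disjoint_left.2 fun x => hγ.notMem_nonwanderingPts hf)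
  tfae_have 6 → 5 := hdisj omegaLimitSet_subset_nonwanderingPts
  tfae_have 5 → 4 := hdisj recurrentPts_subset_omegaLimitSet
  tfae_have 4 → 3 := hdisj periodicPts_subset_recurrentPts
  tfae_have 8 → 7 := by
    rintro ⟨δ, hc, hi, hsub, hdiff, hfix, hlt, hab⟩
    have hγ := hG.isAttractingProng_of_arc hc hi hsub hdiff hfix hlt hab
    rw [hγ.closure_diff]
    refine ⟨singleton_nonempty _, fun x hx => ?_⟩
    simp only [infDist_singleton]
    exact tendsto_iff_dist_tendsto_zero.1 (hγ.tendsto_iterate hf hx)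
  tfae_have 7 → 3 := by
    rintro ⟨hne, h⟩
    have hclosed := (IsStar.finite_closure_diff hG.exists_isStar hXconn).isClosed
    exact disjoint_iff_inter_eq_empty.1 (disjoint_left.2 fun x hx =>
      notMem_periodicPts_of_tendsto_infDist hclosed hne (fun hx' => hx'.2 hx) (h x hx))
  tfae_finish
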